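/- Let T ⊆ ℝ² be the convex hull of three points at pairwise distance 1 (a closed unit equilateral triangle, of area √3/4). For m ≥ 1, call a family U₁, …, Uₘ of pairwise disjoint sets, each open in the subspace topology of T and each of two-dimensional Lebesgue measure (√3/4)/m, an m-part equal-area division of T, and call μH¹((T \ (U₁ ∪ ⋯ ∪ Uₘ)) ∩ interior T) its dividing length. Then the infimum of the dividing lengths over all 2-part equal-area divisions of T equals √(√3·π/12). -/

import Mathlib

open MeasureTheory

section
open MeasureTheory

lemma sweep_small_real (S : Set ℂ) (t : ℝ) (ht : 0 ≤ t) :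
    volume {z : ℂ | ∃ τ ∈ Set.Icc (0:ℝ) 1, z + ((τ * t : ℝ) : ℂ) ∈ S} ≤
      Metric.ediam S * (ENNReal.ofReal t + Metric.ediam S) := by
  rcases S.eq_empty_or_nonempty with rfl | hne
  · simp
  by_cases htop : Metric.ediam S = ⊤
  · simp [htop]
  have hre : Metric.ediam (Complex.re '' S) ≤ Metric.ediam S := by
    have := (Complex.reCLM.lipschitz.ediam_image_le S)
    simp only [Complex.reCLM_nnnorm, ENNReal.coe_one, one_mul] at this
    exact this
  have him : Metric.ediam (Complex.im '' S) ≤ Metric.ediam S := by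
    have := (Complex.imCLM.lipschitz.ediam_image_le S)
    simp only [Complex.imCLM_nnnorm, ENNReal.coe_one, one_mul] at this
    exact this
  have hbre : Bornology.IsBounded (Complex.re '' S) := by
    rw [Metric.isBounded_iff_ediam_ne_top]; exact ne_top_of_le_ne_top htop hre
  have hbim : Bornology.IsBounded (Complex.im '' S) := by
    rw [Metric.isBounded_iff_ediam_ne_top]; exact ne_top_of_le_ne_top htop him
  rw [Real.ediam_eq hbre] at hre
  rw [Real.ediam_eq hbim] at him
  set a := sInf (Complex.re '' S)
  set b := sSup (Complex.re '' S)
  set c := sInf (Complex.im '' S)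
  set d := sSup (Complex.im '' S)
  have hab : a ≤ b := Real.sInf_le_sSup _ hbre.bddBelow hbre.bddAbove
  have hsub : {z : ℂ | ∃ τ ∈ Set.Icc (0:ℝ) 1, z + ((τ * t : ℝ) : ℂ) ∈ S} ⊆
      Complex.measurableEquivRealProd ⁻¹' (Set.Icc (a - t) b ×ˢ Set.Icc c d) := by
    rintro z ⟨τ, ⟨h0, h1⟩, hz⟩
    have e1 := csInf_le hbre.bddBelow (Set.mem_image_of_mem Complex.re hz)
    have e2 := le_csSup hbre.bddAbove (Set.mem_image_of_mem Complex.re hz)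
    have e3 := csInf_le hbim.bddBelow (Set.mem_image_of_mem Complex.im hz)
    have e4 := le_csSup hbim.bddAbove (Set.mem_image_of_mem Complex.im hz)
    simp only [Complex.add_re, Complex.ofReal_re, Complex.add_im, Complex.ofReal_im, add_zero] at e1 e2 e3 e4
    have p1 : 0 ≤ τ * t := by positivity
    have p2 : τ * t ≤ t := by nlinarith
    simp only [Set.mem_preimage, Complex.measurableEquivRealProd_apply, Set.mem_prod, Set.mem_Icc]
    refine ⟨⟨?_, ?_⟩, ?_, ?_⟩ <;> linarith
  refine (measure_mono hsub).trans ?_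
  rw [Complex.volume_preserving_equiv_real_prod.measure_preimage
    ((measurableSet_Icc.prod measurableSet_Icc).nullMeasurableSet), Measure.volume_eq_prod,
    Measure.prod_prod, Real.volume_Icc, Real.volume_Icc, mul_comm]
  gcongr
  rw [show b - (a - t) = t + (b - a) by ring, ENNReal.ofReal_add ht (by linarith)]
  gcongr

lemma exists_rot (v : ℂ) : ∃ u : Circle, (u : ℂ) * (‖v‖ : ℝ) = v := by
  refine ⟨Circle.exp v.arg, ?_⟩
  rw [Circle.coe_exp, mul_comm]
  exact Complex.norm_mul_exp_arg_mul_I v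

lemma sweep_small (S : Set ℂ) (v : ℂ) :
    volume {z : ℂ | ∃ τ ∈ Set.Icc (0:ℝ) 1, z + τ * v ∈ S} ≤
      Metric.ediam S * (ENNReal.ofReal ‖v‖ + Metric.ediam S) := by
  obtain ⟨u, hu⟩ := exists_rot v
  have h1 := sweep_small_real (rotation u ⁻¹' S) ‖v‖ (norm_nonneg v)
  rw [show Metric.ediam (rotation u ⁻¹' S) = Metric.ediam S from
    (rotation u).toIsometryEquiv.ediam_preimage S] at h1
  refine le_trans (le_of_eq ?_) h1
  rw [← (rotation u).measurePreserving.measure_preimage_equiv (f := (rotation u).toHomeomorph.toMeasurableEquiv)]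
  congr 1
  ext z
  simp only [Set.mem_preimage, Set.mem_ofPred_eq]
  have : ∀ τ : ℝ, rotation u (z + ((τ * ‖v‖ : ℝ) : ℂ)) = rotation u z + τ * v := by
    intro τ
    rw [map_add, rotation_apply, rotation_apply, Complex.ofReal_mul]
    rw [show (u:ℂ) * ((τ:ℂ) * (‖v‖:ℝ)) = τ * ((u:ℂ) * (‖v‖:ℝ)) by ring, hu]
  simp only [this]
  rfl

lemma sweep (K : Set ℂ) (v : ℂ) (hK : μH[1] K ≠ ⊤) :
    volume {z : ℂ | ∃ τ ∈ Set.Icc (0:ℝ) 1, z + τ * v ∈ K} ≤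
      ENNReal.ofReal ‖v‖ * μH[1] K := by
  have key : ∀ r : NNReal, 0 < r →
      volume {z : ℂ | ∃ τ ∈ Set.Icc (0:ℝ) 1, z + τ * v ∈ K} ≤
      (ENNReal.ofReal ‖v‖ + r) * (μH[1] K + r) := by
    intro r hr
    have h1 : (⨅ (t : ℕ → Set ℂ), ⨅ (_ : K ⊆ ⋃ n, t n),
            ⨅ (_ : ∀ (n : ℕ), Metric.ediam (t n) ≤ r), ∑' (n : ℕ), ⨆ (_ : (t n).Nonempty), Metric.ediam (t n) ^ (1:ℝ)) < μH[1] K + r := by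
      refine lt_of_le_of_lt ?_ (ENNReal.lt_add_right hK (by simpa using hr.ne'))
      rw [Measure.hausdorffMeasure_apply]
      exact le_iSup₂_of_le (r : ENNReal) (by simpa using hr) le_rfl
    simp only [iInf_lt_iff] at h1
    obtain ⟨t, hKt, hd, hsum⟩ := h1
    calc volume {z : ℂ | ∃ τ ∈ Set.Icc (0:ℝ) 1, z + τ * v ∈ K}
        ≤ volume (⋃ n, {z : ℂ | ∃ τ ∈ Set.Icc (0:ℝ) 1, z + τ * v ∈ t n}) := by
          apply measure_mono
          rintro z ⟨τ, hτ, hz⟩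
          obtain ⟨n, hn⟩ := Set.mem_iUnion.1 (hKt hz)
          exact Set.mem_iUnion.2 ⟨n, τ, hτ, hn⟩
      _ ≤ ∑' n, volume {z : ℂ | ∃ τ ∈ Set.Icc (0:ℝ) 1, z + τ * v ∈ t n} := measure_iUnion_le _
      _ ≤ ∑' n, (ENNReal.ofReal ‖v‖ + r) * ⨆ (_ : (t n).Nonempty), Metric.ediam (t n) ^ (1:ℝ) := by
          gcongr with n
          rcases (t n).eq_empty_or_nonempty with h | h
          · simp [h]
          · simp only [h, iSup_pos, ENNReal.rpow_one]
            refine (sweep_small _ _).trans ?_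
            rw [mul_comm]
            gcongr
            exact hd n
      _ ≤ _ := by
          rw [ENNReal.tsum_mul_left]
          gcongr
  have hlim : Filter.Tendsto (fun r : NNReal => (ENNReal.ofReal ‖v‖ + r) * (μH[1] K + r)) (nhdsWithin 0 (Set.Ioi 0))
      (nhds (ENNReal.ofReal ‖v‖ * μH[1] K)) := by
    have hc : Filter.Tendsto (fun r : NNReal => (r : ENNReal)) (nhdsWithin 0 (Set.Ioi 0)) (nhds 0) := by
      have : Continuous (fun r : NNReal => (r : ENNReal)) := ENNReal.continuous_coe
      simpa using (this.tendsto 0).mono_left nhdsWithin_le_nhds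
    have a1 := (tendsto_const_nhds (x := ENNReal.ofReal ‖v‖)).add hc
    have a2 := (tendsto_const_nhds (x := μH[1] K)).add hc
    simp only [add_zero] at a1 a2
    exact ENNReal.Tendsto.mul a1 (Or.inr hK) a2 (Or.inr (by simp))
  refine ge_of_tendsto hlim ?_
  filter_upwards [self_mem_nhdsWithin] with r hr
  exact key r hr

end

section
open MeasureTheory

lemma seg_frontier {V : Set ℂ} (S : Set ℂ) (hS : IsPreconnected S) {a b : ℂ} (ha : a ∈ S) (hb : b ∈ S)
    (haV : a ∈ V) (hbV : b ∉ V) : ∃ z ∈ S, z ∈ frontier V := by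
  by_contra hcon
  push Not at hcon
  have h := hS (interior V) (interior Vᶜ) isOpen_interior isOpen_interior ?_ ⟨a, ha, ?_⟩ ⟨b, hb, ?_⟩
  · obtain ⟨z, _, h1, h2⟩ := h
    exact interior_subset h2 (interior_subset h1)
  · intro z hz
    have := hcon z hz
    by_contra h
    apply this
    rw [frontier_eq_closure_inter_closure]
    simp only [interior_compl, Set.mem_union, Set.mem_compl_iff, not_or, not_not] at h
    rw [closure_compl]
    exact ⟨h.2, h.1⟩
  · have := hcon a ha
    rw [frontier, Set.mem_sdiff] at this
    by_contra h
    exact this ⟨subset_closure haV, h⟩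
  · have := hcon b hb
    rw [← frontier_compl, frontier, Set.mem_sdiff] at this
    by_contra h
    exact this ⟨subset_closure hbV, h⟩

lemma diff_bound {V Ω : Set ℂ} (hV : IsOpen V) {x v : ℂ} {δ ρ : ℝ} (hρ : δ + ‖v‖ ≤ ρ)
    (hΩ : Metric.ball x ρ ⊆ Ω) (hfin : μH[1] (frontier V ∩ Ω) ≠ ⊤) :
    |volume.real (V ∩ Metric.ball (x + v) δ) - volume.real (V ∩ Metric.ball x δ)| ≤
      ‖v‖ * (μH[1].restrict (frontier V ∩ Ω)).real (Metric.ball x ρ) := by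
  set P : Set ℂ := {z | z ∈ Metric.ball x δ ∧ z + v ∈ V}
  set Q := V ∩ Metric.ball x δ
  have hPm : MeasurableSet P := by
    apply IsOpen.measurableSet
    exact Metric.isOpen_ball.inter (hV.preimage (by fun_prop))
  have hQm : MeasurableSet Q := (hV.inter Metric.isOpen_ball).measurableSet
  have e1 : volume.real (V ∩ Metric.ball (x + v) δ) = volume.real P := by
    rw [measureReal_def, measureReal_def, ← measure_preimage_add_right volume v]
    congr 2
    ext z
    simp [P, Set.mem_preimage, and_comm]
  have hPf : volume P ≠ ⊤ := ne_top_of_le_ne_top (measure_ball_lt_top (μ := volume) (x := x) (r := δ)).ne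
    (measure_mono (fun z hz => hz.1))
  have hQf : volume Q ≠ ⊤ := ne_top_of_le_ne_top (measure_ball_lt_top (μ := volume) (x := x) (r := δ)).ne
    (measure_mono (fun z hz => hz.2))
  rw [e1]
  have hfin' : μH[1] ((frontier V ∩ Ω) ∩ Metric.ball x ρ) ≠ ⊤ :=
    ne_top_of_le_ne_top hfin (measure_mono Set.inter_subset_left)
  have hsw := sweep ((frontier V ∩ Ω) ∩ Metric.ball x ρ) v hfin'
  refine (abs_measureReal_sub_le_measureReal_symmDiff' hPm.nullMeasurableSet hQm.nullMeasurableSet hPf hQf).trans ?_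
  have hsub : symmDiff P Q ⊆ {z : ℂ | ∃ τ ∈ Set.Icc (0:ℝ) 1, z + τ * v ∈ (frontier V ∩ Ω) ∩ Metric.ball x ρ} := by
    have hcv : ∀ z ∈ Metric.ball x δ, ∀ τ ∈ Set.Icc (0:ℝ) 1, z + τ * v ∈ Metric.ball x ρ := by
      intro z hz τ hτ
      rw [mem_ball_iff_norm] at hz ⊢
      calc ‖z + τ * v - x‖ = ‖(z - x) + τ * v‖ := by ring_nf
        _ ≤ ‖z - x‖ + ‖(τ:ℂ) * v‖ := norm_add_le _ _
        _ < δ + ‖v‖ := by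
          have : ‖(τ:ℂ) * v‖ ≤ ‖v‖ := by
            rw [norm_mul, Complex.norm_real, Real.norm_of_nonneg hτ.1]
            nlinarith [norm_nonneg v, hτ.2]
          linarith
        _ ≤ ρ := hρ
    have hconn : ∀ z : ℂ, IsPreconnected ((fun τ : ℝ => z + τ * v) '' Set.Icc (0:ℝ) 1) := by
      intro z
      apply isPreconnected_Icc.image
      fun_prop
    have hmem0 : ∀ z : ℂ, z ∈ ((fun τ : ℝ => z + τ * v) '' Set.Icc (0:ℝ) 1) := fun z =>
      ⟨0, by simp, by simp⟩
    have hmem1 : ∀ z : ℂ, z + v ∈ ((fun τ : ℝ => z + τ * v) '' Set.Icc (0:ℝ) 1) := fun z =>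
      ⟨1, by simp, by simp⟩
    have fin : ∀ z ∈ Metric.ball x δ, (∃ w ∈ ((fun τ : ℝ => z + τ * v) '' Set.Icc (0:ℝ) 1), w ∈ frontier V) →
        ∃ τ ∈ Set.Icc (0:ℝ) 1, z + τ * v ∈ (frontier V ∩ Ω) ∩ Metric.ball x ρ := by
      rintro z hz ⟨w, ⟨τ, hτ, rfl⟩, hw⟩
      have := hcv z hz τ hτ
      exact ⟨τ, hτ, ⟨hw, hΩ this⟩, this⟩
    rintro z (⟨⟨hz1, hz2⟩, hz3⟩ | ⟨⟨hz1, hz2⟩, hz3⟩)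
    · have : z ∉ V := fun h => hz3 ⟨h, hz1⟩
      exact fin z hz1 (seg_frontier _ (hconn z) (hmem1 z) (hmem0 z) hz2 this)
    · have : z + v ∉ V := fun h => hz3 ⟨hz2, h⟩
      exact fin z hz2 (seg_frontier _ (hconn z) (hmem0 z) (hmem1 z) hz1 this)
  have h2 := (measure_mono hsub).trans hsw
  rw [measureReal_def, measureReal_def, Measure.restrict_apply Metric.isOpen_ball.measurableSet,
    Set.inter_comm (Metric.ball x ρ)]
  have h3 := ENNReal.toReal_mono (ENNReal.mul_ne_top (by simp) hfin') h2
  rwa [ENNReal.toReal_mul, ENNReal.toReal_ofReal (norm_nonneg v)] at h3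

lemma measurable_ballmeas (μ : Measure ℂ) [SFinite μ] (ρ : ℝ) : Measurable (fun x : ℂ => μ (Metric.ball x ρ)) := by
  have : MeasurableSet {p : ℂ × ℂ | dist p.2 p.1 < ρ} := by
    apply IsOpen.measurableSet
    exact isOpen_lt (by fun_prop) (by fun_prop)
  exact measurable_measure_prodMk_left this

lemma lintegral_ballmeas (μ : Measure ℂ) [SFinite μ] (ρ : ℝ) :
    ∫⁻ x : ℂ, μ (Metric.ball x ρ) = μ Set.univ * volume (Metric.ball (0:ℂ) ρ) := by
  have hm : MeasurableSet {p : ℂ × ℂ | dist p.2 p.1 < ρ} := by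
    apply IsOpen.measurableSet
    exact isOpen_lt (by fun_prop) (by fun_prop)
  have e1 : ∫⁻ x : ℂ, μ (Metric.ball x ρ) = (volume.prod μ) {p : ℂ × ℂ | dist p.2 p.1 < ρ} :=
    (Measure.prod_apply hm).symm
  have e2 : (volume.prod μ) {p : ℂ × ℂ | dist p.2 p.1 < ρ} = ∫⁻ y : ℂ, volume (Metric.ball y ρ) ∂μ := by
    rw [Measure.prod_apply_symm hm]
    congr 1
    ext y
    congr 1
    ext z
    simp [dist_comm]
  rw [e1, e2]
  simp only [Complex.volume_ball, lintegral_const]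
  rw [mul_comm]

end

section
open MeasureTheory

lemma mollify {V Ω : Set ℂ} (hV : IsOpen V) (hfin : μH[1] (frontier V ∩ Ω) ≠ ⊤)
    {δ κ : ℝ} (hδ : 0 < δ) (hκ : 0 < κ) (hκ1 : κ ≤ 1) :
    ∃ g : ℂ → ℝ, ContDiff ℝ 1 g ∧ (∀ x, 0 ≤ g x) ∧
      (∀ x, Metric.ball x (3 * δ) ⊆ V → g x = 1) ∧
      (∀ x, Disjoint (Metric.ball x (3 * δ)) V → g x = 0) ∧
      (∀ D : Set ℂ, MeasurableSet D → (∀ x ∈ D, Metric.ball x (3 * δ) ⊆ Ω) →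
        ∫⁻ x in D, ‖fderiv ℝ g x‖ₑ ≤ ENNReal.ofReal ((1 + κ)^2) * μH[1] (frontier V ∩ Ω)) := by
  set μ := μH[1].restrict (frontier V ∩ Ω) with hμ
  have : IsFiniteMeasure μ := ⟨by rw [hμ, Measure.restrict_apply_univ]; exact hfin.lt_top⟩
  have hVm : MeasurableSet V := hV.measurableSet
  set c : ℝ := volume.real (Metric.ball (0:ℂ) δ) with hc
  have hcball : ∀ x : ℂ, volume.real (Metric.ball x δ) = c := by
    intro x; simp [hc, measureReal_def, Complex.volume_ball]
  have hcpos : 0 < c := by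
    rw [hc]
    exact ENNReal.toReal_pos (Metric.measure_ball_pos volume _ hδ).ne' measure_ball_lt_top.ne
  set f : ℂ → ℝ := fun x => volume.real (V ∩ Metric.ball x δ) / c with hf
  have hf0 : ∀ x, 0 ≤ f x := fun x => by positivity
  have hf1 : ∀ x, f x ≤ 1 := by
    intro x
    rw [hf]; simp only
    rw [div_le_one hcpos, ← hcball x]
    exact measureReal_mono Set.inter_subset_right measure_ball_lt_top.ne
  have hfm : Measurable f := by
    have := (measurable_ballmeas (volume.restrict V) δ).ennreal_toReal.div_const c
    convert this using 2 with x
    rw [hf]; simp only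
    rw [measureReal_def, Measure.restrict_apply Metric.isOpen_ball.measurableSet, Set.inter_comm]
  have hfone : ∀ x, Metric.ball x δ ⊆ V → f x = 1 := by
    intro x hx
    rw [hf]; simp only
    rw [Set.inter_eq_right.2 hx, hcball, div_self hcpos.ne']
  have hfzero : ∀ x, Disjoint (Metric.ball x δ) V → f x = 0 := by
    intro x hx
    rw [hf]; simp only
    rw [Set.inter_comm, hx.inter_eq]; simp
  let B : ContDiffBump (0:ℂ) := ⟨δ/2, δ, by linarith, by linarith⟩
  set φ : ℂ → ℝ := B.normed volume with hφ
  have hφ0 : ∀ x, 0 ≤ φ x := fun x => B.nonneg_normed x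
  have hφint : ∫ x, φ x = 1 := B.integral_normed
  have hφcs : HasCompactSupport φ := B.hasCompactSupport_normed
  have hφcd : ContDiff ℝ 1 φ := B.contDiff_normed
  have hφc : Continuous φ := hφcd.continuous
  have hφi : Integrable φ := B.integrable_normed
  have hφs : ∀ t, φ t ≠ 0 → ‖t‖ < δ := by
    intro t ht
    have : t ∈ Function.support φ := ht
    rw [hφ, B.support_normed_eq] at this
    simpa [B] using this
  have hbdint : ∀ (k : ℂ → ℝ), Measurable k → (∃ C, ∀ x, |k x| ≤ C) → Integrable (fun t => φ t * k t) := by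
    rintro k hk ⟨C, hC⟩
    exact hφi.mul_bdd (c := C) hk.aestronglyMeasurable (ae_of_all _ hC)
  have hfabs : ∀ x, |f x| ≤ 1 := fun x => by rw [abs_of_nonneg (hf0 x)]; exact hf1 x
  set g : ℂ → ℝ := fun x => ∫ t, φ t * f (x - t) with hg
  have hgcd : ContDiff ℝ 1 g := by
    have hli : LocallyIntegrable f (volume : Measure ℂ) := by
      refine (locallyIntegrable_const (1:ℝ)).mono hfm.aestronglyMeasurable (ae_of_all _ ?_)
      intro x; simpa using hfabs x
    exact_mod_cast hφcs.contDiff_convolution_left (n := 1) (ContinuousLinearMap.mul ℝ ℝ) (by exact_mod_cast hφcd) hli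
  have hgi : ∀ x, Integrable (fun t => φ t * f (x - t)) := fun x =>
    hbdint _ (hfm.comp (measurable_const.sub measurable_id)) ⟨1, fun t => hfabs _⟩
  set ρ := (1 + κ) * δ with hρ
  have hρ0 : 0 < ρ := by positivity
  set G : ℂ → ℝ := fun x => ∫ t, φ t * (μ.real (Metric.ball (x - t) ρ) / c) with hG
  have hμm : Measurable (fun x => μ.real (Metric.ball x ρ) / c) :=
    (measurable_ballmeas μ ρ).ennreal_toReal.div_const c
  have hGi : ∀ x, Integrable (fun t => φ t * (μ.real (Metric.ball (x - t) ρ) / c)) := fun x =>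
    hbdint _ (hμm.comp (measurable_const.sub measurable_id)) ⟨μ.real Set.univ / c, fun t => by
      rw [abs_of_nonneg (by positivity)]
      gcongr
      · exact measure_ne_top _ _
      · exact Set.subset_univ _⟩
  have hG0 : ∀ x, 0 ≤ G x := fun x => integral_nonneg fun t => mul_nonneg (hφ0 t) (by positivity)
  refine ⟨g, hgcd, fun x => integral_nonneg fun t => mul_nonneg (hφ0 t) (hf0 _), ?_, ?_, ?_⟩
  · intro x hx
    rw [← hφint]
    refine integral_congr_ae (ae_of_all _ fun t => ?_)
    simp only
    by_cases ht : φ t = 0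
    · simp [ht]
    · rw [hfone, mul_one]
      refine Set.Subset.trans (Metric.ball_subset_ball' ?_) hx
      have := hφs t ht
      rw [dist_eq_norm]; simp; linarith
  · intro x hx
    rw [hg]; simp only
    rw [← integral_zero ℂ ℝ]
    refine integral_congr_ae (ae_of_all _ fun t => ?_)
    simp only
    by_cases ht : φ t = 0
    · simp [ht]
    · rw [hfzero, mul_zero]
      refine hx.mono_left (Metric.ball_subset_ball' ?_)
      have := hφs t ht
      rw [dist_eq_norm]; simp; linarith
  · intro D hD hDΩ
    have hgrad : ∀ x ∈ D, ‖fderiv ℝ g x‖ₑ ≤ ENNReal.ofReal (G x) := by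
      intro x hx
      rw [← ofReal_norm]
      apply ENNReal.ofReal_le_ofReal
      have hd : HasFDerivAt g (fderiv ℝ g x) x := (hgcd.differentiable one_ne_zero x).hasFDerivAt
      refine hd.le_of_lip' (hG0 x) ?_
      filter_upwards [Metric.ball_mem_nhds x (show 0 < κ * δ by positivity)] with y hy
      rw [mem_ball_iff_norm] at hy
      rw [hg]; simp only
      rw [← integral_sub (hgi y) (hgi x), hG]; simp only
      rw [mul_comm, ← integral_const_mul]
      refine norm_integral_le_of_norm_le ((hGi x).const_mul _) (ae_of_all _ ?_)
      intro t
      by_cases ht : φ t = 0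
      · simp [ht]
      · have ht' := hφs t ht
        have hsub : Metric.ball (x - t) ρ ⊆ Ω := by
          refine Set.Subset.trans (Metric.ball_subset_ball' ?_) (hDΩ x hx)
          rw [dist_eq_norm, hρ]; simp; nlinarith
        have := diff_bound (x := x - t) (v := y - x) (δ := δ) (ρ := ρ) hV (by rw [hρ]; linarith) hsub hfin
        rw [show x - t + (y - x) = y - t by ring] at this
        rw [← mul_sub, norm_mul, Real.norm_of_nonneg (hφ0 t), hf]
        simp only
        rw [← sub_div, norm_div, Real.norm_of_nonneg hcpos.le, Real.norm_eq_abs]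
        calc φ t * (_ / c) ≤ φ t * ((‖y - x‖ * μ.real (Metric.ball (x - t) ρ)) / c) := by
              gcongr
              exact hφ0 t
          _ = _ := by ring
    calc ∫⁻ x in D, ‖fderiv ℝ g x‖ₑ ≤ ∫⁻ x in D, ENNReal.ofReal (G x) := setLIntegral_mono' hD hgrad
      _ ≤ ∫⁻ x, ENNReal.ofReal (G x) := setLIntegral_le_lintegral _ _
      _ = ∫⁻ x, ∫⁻ t, ENNReal.ofReal (φ t) * (μ (Metric.ball (x - t) ρ) / ENNReal.ofReal c) := by
          congr 1; ext x
          rw [hG]; simp only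
          rw [ofReal_integral_eq_lintegral_ofReal (hGi x) (ae_of_all _ fun t => mul_nonneg (hφ0 t) (by positivity))]
          congr 1; ext t
          rw [ENNReal.ofReal_mul (hφ0 t), ENNReal.ofReal_div_of_pos hcpos, ofReal_measureReal]
      _ = ∫⁻ t, ∫⁻ x, ENNReal.ofReal (φ t) * (μ (Metric.ball (x - t) ρ) / ENNReal.ofReal c) := by
          apply lintegral_lintegral_swap
          apply Measurable.aemeasurable
          have h1 : Measurable (fun p : ℂ × ℂ => μ (Metric.ball (p.1 - p.2) ρ)) :=
            (measurable_ballmeas μ ρ).comp (measurable_fst.sub measurable_snd)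
          have h2 : Measurable (fun p : ℂ × ℂ => ENNReal.ofReal (φ p.2)) :=
            (hφc.measurable.comp measurable_snd).ennreal_ofReal
          exact h2.mul (h1.div_const _)
      _ = ∫⁻ t, ENNReal.ofReal (φ t) * (μ Set.univ * volume (Metric.ball (0:ℂ) ρ) / ENNReal.ofReal c) := by
          congr 1; ext t
          have hm := measurable_ballmeas μ ρ
          rw [lintegral_const_mul]
          · congr 1
            simp_rw [div_eq_mul_inv]
            rw [lintegral_mul_const]
            · congr 1
              rw [lintegral_sub_right_eq_self (fun x => μ (Metric.ball x ρ)), lintegral_ballmeas]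
            · exact hm.comp (measurable_id.sub measurable_const)
          · exact (hm.comp (measurable_id.sub measurable_const)).div_const _
      _ = μ Set.univ * volume (Metric.ball (0:ℂ) ρ) / ENNReal.ofReal c := by
          rw [lintegral_mul_const _ hφc.measurable.ennreal_ofReal,
            ← ofReal_integral_eq_lintegral_ofReal hφi (ae_of_all _ hφ0), hφint]
          simp
      _ = _ := by
          have e1 : μ Set.univ = μH[1] (frontier V ∩ Ω) := by rw [hμ, Measure.restrict_apply_univ]
          have e2 : ENNReal.ofReal c = volume (Metric.ball (0:ℂ) δ) := by
            rw [hc, ofReal_measureReal measure_ball_lt_top.ne]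
          have e3 : volume (Metric.ball (0:ℂ) ρ) = ENNReal.ofReal ((1 + κ)^2) * volume (Metric.ball (0:ℂ) δ) := by
            rw [Complex.volume_ball, Complex.volume_ball, hρ, ENNReal.ofReal_mul (by positivity), mul_pow,
              ENNReal.ofReal_pow (by positivity), mul_assoc]
          rw [e1, e3, ← e2, mul_div_assoc, ENNReal.mul_div_cancel_right (by simpa using hcpos) (by simp), mul_comm]

end

section
open MeasureTheory intervalIntegral

lemma oneD {h h' : ℝ → ℝ} {R : ℝ} (hR : 0 ≤ R) (hd : ∀ r, HasDerivAt h (h' r) r) (hc : Continuous h')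
    (h0 : ∀ r, 0 ≤ h r) (hz : h R = 0) :
    2 * ∫ r in (0:ℝ)..R, r * h r ^ 2 ≤ (∫ r in (0:ℝ)..R, h r) * ∫ r in (0:ℝ)..R, r * |h' r| ∧
    (∫ r in (0:ℝ)..R, h r) ≤ ∫ r in (0:ℝ)..R, r * |h' r| := by
  have hcont : Continuous h := continuous_iff_continuousAt.2 fun r => (hd r).continuousAt
  set F : ℝ → ℝ := fun r => ∫ x in (0:ℝ)..r, h x with hF
  set Λ := ∫ r in (0:ℝ)..R, h r with hΛ
  set S := ∫ r in (0:ℝ)..R, r * |h' r| with hS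
  have hFd : ∀ r, HasDerivAt F (h r) r := fun r =>
    integral_hasDerivAt_right (hcont.intervalIntegrable _ _) hcont.stronglyMeasurable.stronglyMeasurableAtFilter hcont.continuousAt
  have hFc : Continuous F := continuous_iff_continuousAt.2 fun r => (hFd r).continuousAt
  have hi : ∀ a b, ∫ r in a..b, (h r + r * h' r) = b * h b - a * h a := by
    intro a b
    refine integral_eq_sub_of_hasDerivAt (f := fun r => r * h r) (fun r _ => ?_) ?_
    · have := (hasDerivAt_id' r).fun_mul (hd r)
      simp only [one_mul] at this
      exact this
    · exact (by fun_prop : Continuous fun r => h r + r * h' r).intervalIntegrable _ _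
  have hsplit : ∀ a b, ∫ r in a..b, (h r + r * h' r) = (∫ r in a..b, h r) + ∫ r in a..b, r * h' r := fun a b =>
    integral_add (hcont.intervalIntegrable _ _) ((by fun_prop : Continuous fun r => r * h' r).intervalIntegrable _ _)
  have habs : ∀ a b, 0 ≤ a → a ≤ b → |∫ r in a..b, r * h' r| ≤ ∫ r in a..b, r * |h' r| := by
    intro a b ha hab
    refine (abs_integral_le_integral_abs hab).trans (le_of_eq ?_)
    refine integral_congr fun r hr => ?_
    rw [Set.uIcc_of_le hab] at hr
    simp only [abs_mul]
    rw [abs_of_nonneg (ha.trans hr.1)]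
  have key : ∀ r ∈ Set.Icc 0 R, 2 * (r * h r) ≤ S + 2 * F r - Λ := by
    intro r hr
    have e1 := hi 0 r
    have e2 := hi r R
    rw [hsplit] at e1 e2
    have a1 := habs 0 r le_rfl hr.1
    have a2 := habs r R hr.1 hr.2
    have s1 : (∫ x in (0:ℝ)..r, x * |h' x|) + ∫ x in r..R, x * |h' x| = S :=
      integral_add_adjacent_intervals ((by fun_prop : Continuous fun r => r * |h' r|).intervalIntegrable _ _)
        ((by fun_prop : Continuous fun r => r * |h' r|).intervalIntegrable _ _)
    have s2 : F r + ∫ x in r..R, h x = Λ :=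
      integral_add_adjacent_intervals (hcont.intervalIntegrable _ _) (hcont.intervalIntegrable _ _)
    rw [hz] at e2
    have b1 := (abs_le.1 a1).2
    have b2 := (abs_le.1 a2).1
    have : (∫ x in (0:ℝ)..r, h x) = F r := rfl
    rw [this] at e1
    linarith
  constructor
  · have e1 : 2 * ∫ r in (0:ℝ)..R, r * h r ^ 2 ≤ ∫ r in (0:ℝ)..R, (h r * (S - Λ) + 2 * F r * h r) := by
      rw [← intervalIntegral.integral_const_mul]
      refine integral_mono_on hR ((by fun_prop : Continuous fun r => 2 * (r * h r ^ 2)).intervalIntegrable _ _)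
        ((by fun_prop : Continuous fun r => (h r * (S - Λ) + 2 * F r * h r)).intervalIntegrable _ _) ?_
      intro r hr
      nlinarith [key r hr, h0 r]
    have e2 : ∫ r in (0:ℝ)..R, 2 * F r * h r = Λ ^ 2 := by
      rw [integral_eq_sub_of_hasDerivAt (f := fun r => F r ^ 2)]
      · simp [hF, hΛ]
      · intro r _
        have := (hFd r).fun_pow 2
        simp only [Nat.cast_ofNat, Nat.add_one_sub_one, pow_one] at this
        exact this
      · exact (by fun_prop : Continuous fun r => 2 * F r * h r).intervalIntegrable _ _
    rw [intervalIntegral.integral_add ((by fun_prop : Continuous fun r => h r * (S - Λ)).intervalIntegrable _ _)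
      ((by fun_prop : Continuous fun r => 2 * F r * h r).intervalIntegrable _ _), e2, intervalIntegral.integral_mul_const] at e1
    nlinarith
  · have := key R ⟨hR, le_rfl⟩
    rw [hz] at this
    have hFR : F R = Λ := rfl
    have k0 := key 0 ⟨le_rfl, hR⟩
    have hF0 : F 0 = 0 := by simp [hF]
    rw [hF0] at k0
    linarith

lemma polar_ineq {g : ℂ → ℝ} (hg : ContDiff ℝ 1 g) (g0 : ∀ z, 0 ≤ g z) {R α : ℝ} (hR : 0 ≤ R)
    (hα : 0 < α) (hα2 : α ≤ 2)
    (hz : ∀ z, R ≤ ‖z‖ → g z = 0) :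
    2 * α * ∫ θ in (0:ℝ)..α, ∫ r in (0:ℝ)..R, r * g (r * Complex.exp (θ * Complex.I)) ^ 2 ≤
      (∫ θ in (0:ℝ)..α, ∫ r in (0:ℝ)..R, r * ‖fderiv ℝ g (r * Complex.exp (θ * Complex.I))‖) ^ 2 := by
  set P : ℝ → ℝ → ℂ := fun r θ => r * Complex.exp (θ * Complex.I) with hP
  set e : ℝ → ℂ := fun θ => Complex.exp (θ * Complex.I) with he
  have hDc : Continuous (fderiv ℝ g) := hg.continuous_fderiv one_ne_zero
  have hgc : Continuous g := hg.continuous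
  have hPc : Continuous (Function.uncurry P) := by
    simp only [hP, Function.uncurry_def]; fun_prop
  have hec : Continuous e := by fun_prop
  set h : ℝ → ℝ → ℝ := fun r θ => g (P r θ) with hh
  set A : ℝ → ℝ → ℝ := fun r θ => fderiv ℝ g (P r θ) (e θ) with hA
  set B : ℝ → ℝ → ℝ := fun r θ => fderiv ℝ g (P r θ) (P r θ * Complex.I) with hB
  set N : ℝ → ℝ → ℝ := fun r θ => ‖fderiv ℝ g (P r θ)‖ with hN
  have hDP : Continuous (fun p : ℝ × ℝ => fderiv ℝ g (P p.1 p.2)) := hDc.comp hPc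
  have hhc : Continuous (fun p : ℝ × ℝ => h p.1 p.2) := hgc.comp hPc
  have hAc : Continuous (fun p : ℝ × ℝ => A p.1 p.2) := hDP.clm_apply (hec.comp continuous_snd)
  have hBc : Continuous (fun p : ℝ × ℝ => B p.1 p.2) := hDP.clm_apply (Continuous.mul hPc continuous_const)
  have hNc : Continuous (fun p : ℝ × ℝ => N p.1 p.2) := hDP.norm
  have hdr : ∀ θ r, HasDerivAt (fun r => h r θ) (A r θ) r := by
    intro θ r
    have h1 : HasDerivAt (fun r : ℝ => P r θ) (e θ) r := by
      simpa [hP, he] using (Complex.ofRealCLM.hasDerivAt (x := r)).mul_const (Complex.exp (θ * Complex.I))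
    exact ((hg.differentiable one_ne_zero (P r θ)).hasFDerivAt).comp_hasDerivAt r h1
  have hdθ : ∀ r θ, HasDerivAt (fun θ => h r θ) (B r θ) θ := by
    intro r θ
    have h1 : HasDerivAt (fun θ : ℝ => P r θ) (P r θ * Complex.I) θ := by
      have h2 : HasDerivAt (fun θ : ℝ => (θ:ℂ) * Complex.I) Complex.I θ := by
        simpa using (Complex.ofRealCLM.hasDerivAt (x := θ)).mul_const Complex.I
      simpa [hP, mul_assoc] using (h2.cexp).const_mul (r:ℂ)
    exact ((hg.differentiable one_ne_zero (P r θ)).hasFDerivAt).comp_hasDerivAt θ h1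
  have cr : ∀ {k : ℝ → ℝ → ℝ}, Continuous (fun p : ℝ × ℝ => k p.1 p.2) → ∀ θ, Continuous fun r => k r θ :=
    fun hk θ => hk.comp (by fun_prop : Continuous fun r : ℝ => (r, θ))
  have cθ : ∀ {k : ℝ → ℝ → ℝ}, Continuous (fun p : ℝ × ℝ => k p.1 p.2) → ∀ r, Continuous fun θ => k r θ :=
    fun hk r => hk.comp (by fun_prop : Continuous fun θ : ℝ => (r, θ))
  have cI : ∀ {k : ℝ → ℝ → ℝ}, Continuous (fun p : ℝ × ℝ => k p.1 p.2) →
      Continuous fun θ => ∫ r in (0:ℝ)..R, k r θ := by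
    intro k hk
    refine continuous_parametric_intervalIntegral_of_continuous' (f := fun θ r => k r θ) ?_ _ _
    exact hk.comp continuous_swap
  have hrA : Continuous (fun p : ℝ × ℝ => p.1 * |A p.1 p.2|) := by fun_prop
  have hrN : Continuous (fun p : ℝ × ℝ => p.1 * N p.1 p.2) := by fun_prop
  have hrh : Continuous (fun p : ℝ × ℝ => p.1 * h p.1 p.2 ^ 2) := by fun_prop
  have hBabs : Continuous (fun p : ℝ × ℝ => |B p.1 p.2|) := by fun_prop
  set Λ : ℝ → ℝ := fun θ => ∫ r in (0:ℝ)..R, h r θ with hΛ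
  set S : ℝ → ℝ := fun θ => ∫ r in (0:ℝ)..R, r * |A r θ| with hS
  set W : ℝ → ℝ := fun θ => ∫ r in (0:ℝ)..R, |B r θ| with hW
  set J : ℝ → ℝ := fun θ => ∫ r in (0:ℝ)..R, r * N r θ with hJ
  have hΛc : Continuous Λ := cI hhc
  have hSc : Continuous S := cI (k := fun r θ => r * |A r θ|) hrA
  have hWc : Continuous W := cI (k := fun r θ => |B r θ|) hBabs
  have hJc : Continuous J := cI (k := fun r θ => r * N r θ) hrN
  have h1d : ∀ θ, 2 * ∫ r in (0:ℝ)..R, r * h r θ ^ 2 ≤ Λ θ * S θ ∧ Λ θ ≤ S θ := by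
    intro θ
    refine oneD hR (hdr θ) (cr hAc θ) (fun r => g0 _) ?_
    apply hz
    simp [hP, abs_of_nonneg hR, Complex.norm_exp_ofReal_mul_I]
  set s := ∫ θ in (0:ℝ)..α, S θ with hs
  set w := ∫ θ in (0:ℝ)..α, W θ with hw
  set lam := ∫ θ in (0:ℝ)..α, Λ θ with hlam
  have hW0 : ∀ θ, 0 ≤ W θ := fun θ => integral_nonneg hR fun r _ => abs_nonneg _
  have hS0 : ∀ θ, 0 ≤ S θ := fun θ => integral_nonneg hR fun r hr => mul_nonneg hr.1 (abs_nonneg _)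
  have hw0 : 0 ≤ w := integral_nonneg hα.le fun θ _ => hW0 θ
  have hs0 : 0 ≤ s := integral_nonneg hα.le fun θ _ => hS0 θ
  -- oscillation
  have hosc : ∀ a ∈ Set.Icc 0 α, ∀ b ∈ Set.Icc 0 α, Λ b ≤ Λ a + w := by
    intro a ha b hb
    have hwsw : w = ∫ r in (0:ℝ)..R, ∫ θ in (0:ℝ)..α, |B r θ| := by
      rw [hw, hW]
      simp only
      rw [integral_of_le hα.le, integral_of_le hR]
      simp only [integral_of_le hα.le, integral_of_le hR]
      apply integral_integral_swap
      rw [Measure.prod_restrict]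
      have hcs : Continuous (Function.uncurry fun x y => |B y x|) := hBabs.comp continuous_swap
      exact (hcs.continuousOn.integrableOn_compact (isCompact_Icc.prod isCompact_Icc)).mono_set
        (Set.prod_mono Set.Ioc_subset_Icc_self Set.Ioc_subset_Icc_self)
    have e1 : Λ b - Λ a = ∫ r in (0:ℝ)..R, (h r b - h r a) :=
      (integral_sub ((cr hhc b).intervalIntegrable _ _) ((cr hhc a).intervalIntegrable _ _)).symm
    have e2 : Λ b - Λ a ≤ w := by
      rw [e1, hwsw]
      refine integral_mono_on hR (((cr hhc b).sub (cr hhc a)).intervalIntegrable _ _) ?_ ?_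
      · refine Continuous.intervalIntegrable ?_ _ _
        exact continuous_parametric_intervalIntegral_of_continuous' (f := fun r θ => |B r θ|) hBabs _ _
      · intro r hr
        have : h r b - h r a = ∫ θ in a..b, B r θ :=
          (integral_eq_sub_of_hasDerivAt (fun θ _ => hdθ r θ) ((cθ hBc r).intervalIntegrable _ _)).symm
        rw [this]
        have hc2 : Continuous fun θ => |B r θ| := (cθ hBc r).abs
        have n1 := norm_integral_le_abs_integral_norm (f := fun θ => B r θ) (a := a) (b := b) (μ := volume)
        simp only [Real.norm_eq_abs] at n1
        refine (le_abs_self _).trans (n1.trans ?_)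
        have n2 := abs_integral_mono_interval (f := fun θ => |B r θ|) (a := a) (b := b) (c := 0) (d := α) (μ := volume)
          (by
            rw [Set.uIoc_of_le hα.le]
            exact Set.Ioc_subset_Ioc (le_min ha.1 hb.1) (max_le ha.2 hb.2))
          (Filter.Eventually.of_forall fun θ => abs_nonneg _) (hc2.intervalIntegrable _ _)
        refine n2.trans (le_of_eq (abs_of_nonneg (integral_nonneg hα.le fun θ _ => abs_nonneg _)))
    linarith
  obtain ⟨θ0, hθ0, hmin⟩ := isCompact_Icc.exists_isMinOn (Set.nonempty_Icc.2 hα.le) hΛc.continuousOn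
  set m := Λ θ0 with hm
  have hmle : ∀ θ ∈ Set.Icc 0 α, m ≤ Λ θ := fun θ hθ => hmin hθ
  have hm0 : 0 ≤ m := integral_nonneg hR fun r _ => g0 _
  have hlam1 : α * m ≤ lam := by
    have : ∫ θ in (0:ℝ)..α, m ≤ lam :=
      integral_mono_on hα.le (continuous_const.intervalIntegrable _ _) (hΛc.intervalIntegrable _ _) hmle
    simpa using this
  have hlam2 : lam ≤ s :=
      integral_mono_on hα.le (hΛc.intervalIntegrable _ _) (hSc.intervalIntegrable _ _) fun θ _ => (h1d θ).2
  have hint : 2 * ∫ θ in (0:ℝ)..α, ∫ r in (0:ℝ)..R, r * h r θ ^ 2 ≤ (m + w) * s + m * lam - α * (m * (m + w)) := by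
    have e1 : ∫ θ in (0:ℝ)..α, ((m + w) * S θ + m * Λ θ - m * (m + w)) = (m + w) * s + m * lam - α * (m * (m + w)) := by
      rw [intervalIntegral.integral_sub, intervalIntegral.integral_add, intervalIntegral.integral_const_mul, intervalIntegral.integral_const_mul]
      · rw [intervalIntegral.integral_const, sub_zero, smul_eq_mul]
      all_goals exact Continuous.intervalIntegrable (by fun_prop) _ _
    rw [← e1, ← intervalIntegral.integral_const_mul]
    refine integral_mono_on hα.le ?_ (Continuous.intervalIntegrable (by fun_prop) _ _) ?_
    · exact ((cI (k := fun r θ => r * h r θ ^ 2) hrh).const_mul 2).intervalIntegrable _ _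
    · intro θ hθ
      have a1 := (h1d θ).1
      have a2 := (h1d θ).2
      have a3 := hmle θ hθ
      have a4 := hosc θ0 hθ0 θ hθ
      nlinarith [mul_nonneg (sub_nonneg.2 a4) (sub_nonneg.2 (a3.trans a2))]
  have hsw : 2 * α * ∫ θ in (0:ℝ)..α, ∫ r in (0:ℝ)..R, r * h r θ ^ 2 ≤ s ^ 2 + w ^ 2 := by
    have e1 : α * (2 * ∫ θ in (0:ℝ)..α, ∫ r in (0:ℝ)..R, r * h r θ ^ 2) ≤
       α * ((m + w) * s + m * lam - α * (m * (m + w))) := by gcongr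
    have e2 : α * m * lam ≤ α * m * s := by gcongr
    have e3 : (α * w) ^ 2 ≤ 4 * w ^ 2 := by
      have : α ^ 2 ≤ 4 := by nlinarith
      rw [mul_pow]; exact mul_le_mul_of_nonneg_right this (sq_nonneg w)
    nlinarith [sq_nonneg (2 * (s - α * m) - α * w)]
  have hvec : s ^ 2 + w ^ 2 ≤ (∫ θ in (0:ℝ)..α, J θ) ^ 2 := by
    set q := Real.sqrt (s ^ 2 + w ^ 2) with hq
    have hqq : q ^ 2 = s ^ 2 + w ^ 2 := Real.sq_sqrt (by positivity)
    have hq0 : 0 ≤ q := Real.sqrt_nonneg _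
    have pt : ∀ r θ, 0 ≤ r → s * (r * |A r θ|) + w * |B r θ| ≤ q * (r * N r θ) := by
      intro r θ hr
      obtain ⟨σ, hσ, hσ2⟩ : ∃ σ : ℝ, |A r θ| = σ * A r θ ∧ σ ^ 2 = 1 := by
        rcases abs_choice (A r θ) with h | h
        · exact ⟨1, by rw [h]; ring, by norm_num⟩
        · exact ⟨-1, by rw [h]; ring, by norm_num⟩
      obtain ⟨τ, hτ, hτ2⟩ : ∃ τ : ℝ, |B r θ| = τ * B r θ ∧ τ ^ 2 = 1 := by
        rcases abs_choice (B r θ) with h | h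
        · exact ⟨1, by rw [h]; ring, by norm_num⟩
        · exact ⟨-1, by rw [h]; ring, by norm_num⟩
      have e1 : s * (r * |A r θ|) + w * |B r θ| =
          fderiv ℝ g (P r θ) ((r * ((s * σ : ℝ) + (w * τ : ℝ) * Complex.I)) * e θ) := by
        rw [hσ, hτ, hA, hB]
        simp only
        have : ((r * ((s * σ : ℝ) + (w * τ : ℝ) * Complex.I)) * e θ : ℂ) = (r * (s * σ)) • e θ + (w * τ) • (P r θ * Complex.I) := by
          simp only [hP, he, Complex.real_smul]; push_cast; ring
        rw [this, map_add, map_smul, map_smul, smul_eq_mul, smul_eq_mul]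
        ring
      rw [e1]
      refine (le_abs_self _).trans ?_
      rw [← Real.norm_eq_abs]
      refine (ContinuousLinearMap.le_opNorm _ _).trans (le_of_eq ?_)
      have : ‖((s * σ : ℝ) + (w * τ : ℝ) * Complex.I : ℂ)‖ = q := by
        rw [Complex.norm_add_mul_I, hq, mul_pow, mul_pow, hσ2, hτ2, mul_one, mul_one]
      rw [norm_mul, norm_mul, this, Complex.norm_real, Real.norm_of_nonneg hr]
      simp only [he, Complex.norm_exp_ofReal_mul_I, hN]
      ring
    have e2 : s * s + w * w ≤ q * ∫ θ in (0:ℝ)..α, J θ := by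
      have : ∫ θ in (0:ℝ)..α, (s * S θ + w * W θ) = s * s + w * w := by
        rw [intervalIntegral.integral_add, intervalIntegral.integral_const_mul, intervalIntegral.integral_const_mul]
        all_goals exact Continuous.intervalIntegrable (by fun_prop) _ _
      rw [← this, ← intervalIntegral.integral_const_mul]
      refine integral_mono_on hα.le (Continuous.intervalIntegrable (by fun_prop) _ _) (Continuous.intervalIntegrable (by fun_prop) _ _) ?_
      intro θ hθ
      simp only [hS, hW, hJ]
      rw [← intervalIntegral.integral_const_mul, ← intervalIntegral.integral_const_mul, ← intervalIntegral.integral_const_mul,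
        ← intervalIntegral.integral_add]
      · refine integral_mono_on hR ?_ ?_ fun r hr => pt r θ hr.1
        · exact ((cr (k := fun r θ => s * (r * |A r θ|) + w * |B r θ|) (by fun_prop)) θ).intervalIntegrable _ _
        · exact ((cr (k := fun r θ => q * (r * N r θ)) (by fun_prop)) θ).intervalIntegrable _ _
      · exact ((cr (k := fun r θ => s * (r * |A r θ|)) (by fun_prop)) θ).intervalIntegrable _ _
      · exact ((cr (k := fun r θ => w * |B r θ|) (by fun_prop)) θ).intervalIntegrable _ _
    have hJ0 : 0 ≤ ∫ θ in (0:ℝ)..α, J θ := integral_nonneg hα.le fun θ _ => integral_nonneg hR fun r hr => mul_nonneg hr.1 (norm_nonneg _)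
    rcases hq0.eq_or_lt with h | h
    · rw [← hqq, ← h]; simpa using sq_nonneg _
    · have : q ≤ ∫ θ in (0:ℝ)..α, J θ := by
        by_contra hcon
        push Not at hcon
        nlinarith
      rw [← hqq]; gcongr
  exact hsw.trans hvec

end

section
open MeasureTheory

def cone : Set ℂ := {z | 0 < z.im ∧ z.im < Real.sqrt 3 * z.re}

lemma cone_open : IsOpen cone :=
  (isOpen_lt continuous_const Complex.continuous_im).inter
    (isOpen_lt Complex.continuous_im (continuous_const.mul Complex.continuous_re))

lemma cone_polar {r θ : ℝ} (hr : 0 < r) (hθ : θ ∈ Set.Ioo (-Real.pi) Real.pi) :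
    (r * Complex.exp (θ * Complex.I) : ℂ) ∈ cone ↔ θ ∈ Set.Ioo 0 (Real.pi / 3) := by
  have hre : (r * Complex.exp (θ * Complex.I) : ℂ).re = r * Real.cos θ := by
    rw [Complex.re_ofReal_mul, Complex.exp_ofReal_mul_I_re]
  have him : (r * Complex.exp (θ * Complex.I) : ℂ).im = r * Real.sin θ := by
    rw [Complex.im_ofReal_mul, Complex.exp_ofReal_mul_I_im]
  have hs : Real.sin θ - Real.sqrt 3 * Real.cos θ = 2 * Real.sin (θ - Real.pi / 3) := by
    rw [Real.sin_sub, Real.cos_pi_div_three, Real.sin_pi_div_three]; ring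
  have hpi := Real.pi_pos
  simp only [cone, Set.mem_ofPred_eq, hre, him, Set.mem_Ioo]
  have e1 : r * Real.sin θ < Real.sqrt 3 * (r * Real.cos θ) ↔ Real.sin (θ - Real.pi/3) < 0 := by
    constructor
    · intro h
      have : r * Real.sin θ < r * (Real.sqrt 3 * Real.cos θ) := by linarith
      have := lt_of_mul_lt_mul_left this hr.le
      linarith
    · intro h
      have : Real.sin θ < Real.sqrt 3 * Real.cos θ := by linarith
      have := mul_lt_mul_of_pos_left this hr
      linarith
  rw [e1, mul_pos_iff_of_pos_left hr]
  constructor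
  · rintro ⟨h1, h2⟩
    have : 0 < θ := by
      by_contra h
      push Not at h
      have := Real.sin_nonpos_of_nonpos_of_neg_pi_le h hθ.1.le
      linarith
    refine ⟨this, ?_⟩
    by_contra h
    push Not at h
    have := Real.sin_nonneg_of_nonneg_of_le_pi (x := θ - Real.pi/3) (by linarith) (by linarith [hθ.2])
    linarith
  · rintro ⟨h1, h2⟩
    exact ⟨Real.sin_pos_of_pos_of_lt_pi h1 hθ.2, Real.sin_neg_of_neg_of_neg_pi_lt (by linarith) (by linarith)⟩

lemma polar_change {F : ℂ → ℝ} {R : ℝ} (hR : 0 ≤ R) (hF : ∀ z, R < ‖z‖ → F z = 0)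
    (hI : IntegrableOn (fun p : ℝ × ℝ => p.1 * F (p.1 * Complex.exp (p.2 * Complex.I)))
      (Set.Ioc 0 R ×ˢ Set.Ioc 0 (Real.pi / 3))) :
    ∫ z in cone, F z = ∫ θ in (0:ℝ)..(Real.pi/3), ∫ r in (0:ℝ)..R, r * F (r * Complex.exp (θ * Complex.I)) := by
  have hpi := Real.pi_pos
  rw [← integral_indicator cone_open.measurableSet, ← Complex.integral_comp_polarCoord_symm]
  have hsub : Set.Ioc 0 R ×ˢ Set.Ioo 0 (Real.pi / 3) ⊆ polarCoord.target := by
    rintro ⟨r, θ⟩ ⟨h1, h2⟩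
    simp only [polarCoord_target, Set.mem_prod, Set.mem_Ioi, Set.mem_Ioo, Set.mem_Ioc] at *
    exact ⟨h1.1, by linarith, by linarith⟩
  have e1 : ∫ p in polarCoord.target, p.1 • cone.indicator F (Complex.polarCoord.symm p) =
      ∫ p in polarCoord.target, (Set.Ioc 0 R ×ˢ Set.Ioo 0 (Real.pi / 3)).indicator
        (fun p : ℝ × ℝ => p.1 * F (p.1 * Complex.exp (p.2 * Complex.I))) p := by
    refine setIntegral_congr_fun polarCoord.open_target.measurableSet ?_
    rintro ⟨r, θ⟩ h
    simp only [polarCoord_target, Set.mem_prod, Set.mem_Ioi] at h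
    have e : Complex.polarCoord.symm (r, θ) = (r * Complex.exp (θ * Complex.I) : ℂ) := by
      rw [Complex.polarCoord_symm_apply, Complex.exp_mul_I]; simp
    simp only [e, smul_eq_mul]
    have hc := cone_polar h.1 h.2
    by_cases h1 : θ ∈ Set.Ioo 0 (Real.pi / 3)
    · rw [Set.indicator_of_mem (hc.2 h1)]
      by_cases h2 : r ≤ R
      · have hm : (r, θ) ∈ Set.Ioc 0 R ×ˢ Set.Ioo 0 (Real.pi / 3) := ⟨⟨h.1, h2⟩, h1⟩
        rw [Set.indicator_of_mem hm]
      · rw [Set.indicator_of_notMem (fun hh => h2 hh.1.2), hF, mul_zero]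
        simpa [Complex.norm_exp_ofReal_mul_I, abs_of_pos h.1] using h2
    · rw [Set.indicator_of_notMem (fun hh => h1 (hc.1 hh)), Set.indicator_of_notMem (fun hh => h1 hh.2), mul_zero]
  rw [e1, setIntegral_indicator (measurableSet_Ioc.prod measurableSet_Ioo), Set.inter_eq_self_of_subset_right hsub]
  have e2 : (Set.Ioc 0 R ×ˢ Set.Ioo 0 (Real.pi / 3)) =ᵐ[volume] (Set.Ioc 0 R ×ˢ Set.Ioc 0 (Real.pi / 3)) := by
    rw [Measure.volume_eq_prod]
    exact Measure.set_prod_ae_eq (Filter.EventuallyEq.refl _ _) Ioo_ae_eq_Ioc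
  rw [setIntegral_congr_set e2, Measure.volume_eq_prod, setIntegral_prod _ (by rwa [← Measure.volume_eq_prod])]
  simp only [intervalIntegral.integral_of_le hR]
  rw [intervalIntegral.integral_of_le (by positivity)]
  apply integral_integral_swap
  rw [Measure.prod_restrict, ← Measure.volume_eq_prod]
  exact hI

lemma cone_ineq {g : ℂ → ℝ} (hg : ContDiff ℝ 1 g) (g0 : ∀ z, 0 ≤ g z) {R : ℝ} (hR : 0 ≤ R)
    (hz : ∀ z, R ≤ ‖z‖ → g z = 0) :
    2 * (Real.pi / 3) * ∫ z in cone, g z ^ 2 ≤ (∫ z in cone, ‖fderiv ℝ g z‖) ^ 2 := by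
  have hpi := Real.pi_pos
  have hDc : Continuous (fderiv ℝ g) := hg.continuous_fderiv one_ne_zero
  have hgc : Continuous g := hg.continuous
  have key : ∀ {k : ℂ → ℝ}, Continuous k → IntegrableOn (fun p : ℝ × ℝ => p.1 * k (p.1 * Complex.exp (p.2 * Complex.I)))
      (Set.Ioc 0 R ×ˢ Set.Ioc 0 (Real.pi / 3)) := by
    intro k hk
    have : Continuous (fun p : ℝ × ℝ => p.1 * k (p.1 * Complex.exp (p.2 * Complex.I))) := by fun_prop
    exact (this.continuousOn.integrableOn_compact (isCompact_Icc.prod isCompact_Icc)).mono_set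
        (Set.prod_mono Set.Ioc_subset_Icc_self Set.Ioc_subset_Icc_self)
  have hd : ∀ z, R < ‖z‖ → ‖fderiv ℝ g z‖ = 0 := by
    intro z hzR
    have : g =ᶠ[nhds z] fun _ => 0 := by
      filter_upwards [(isOpen_lt continuous_const continuous_norm).mem_nhds hzR] with y hy
      exact hz y (le_of_lt hy)
    rw [this.fderiv_eq]; simp
  rw [polar_change hR (F := fun z => g z ^ 2) (fun z h => by simp [hz z h.le]) (key (k := fun z => g z ^ 2) (by fun_prop)),
    polar_change hR (F := fun z => ‖fderiv ℝ g z‖) hd (key (k := fun z => ‖fderiv ℝ g z‖) (by fun_prop))]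
  exact polar_ineq hg g0 hR (by positivity) (by linarith [Real.pi_lt_four]) hz

end

section
open MeasureTheory

lemma cone_shift {z w : ℂ} {ε : ℝ} (hz : z ∈ cone) (hε : 0 < ε) (hw : ‖w‖ < ε / 4) :
    z + ε * ⟨Real.sqrt 3 / 2, 1 / 2⟩ + w ∈ cone := by
  have h3 : Real.sqrt 3 * Real.sqrt 3 = 3 := Real.mul_self_sqrt (by norm_num)
  have h3' : Real.sqrt 3 ≤ 2 := by rw [Real.sqrt_le_left (by norm_num)]; norm_num
  have h30 : 0 ≤ Real.sqrt 3 := Real.sqrt_nonneg _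
  obtain ⟨a1, a2⟩ := abs_lt.1 ((Complex.abs_im_le_norm w).trans_lt hw)
  obtain ⟨b1, b2⟩ := abs_lt.1 ((Complex.abs_re_le_norm w).trans_lt hw)
  obtain ⟨c1, c2⟩ := hz
  constructor
  · simp; linarith
  · simp; nlinarith

lemma mollify_ball {V : Set ℂ} {M δ : ℝ} (hb : ∀ z ∈ V, ‖z‖ < M) (x : ℂ) (hx : M + 3 * δ ≤ ‖x‖) :
    Disjoint (Metric.ball x (3*δ)) V := by
  rw [Set.disjoint_left]
  intro y hy hV
  have h1 := hb y hV
  rw [Metric.mem_ball, dist_eq_norm] at hy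
  have := norm_sub_norm_le x y
  rw [norm_sub_rev] at this
  linarith

lemma lintegral_shift (D : Set ℂ) (hD : MeasurableSet D) (f : ℂ → ENNReal) (v : ℂ) :
    ∫⁻ z in D, f (z + v) = ∫⁻ z in {z | z - v ∈ D}, f z := by
  have hD' : MeasurableSet {z | z - v ∈ D} := (measurable_id.sub_const v) hD
  rw [← lintegral_indicator hD, ← lintegral_indicator hD', ← lintegral_add_right_eq_self (Set.indicator {z | z - v ∈ D} f) v]
  congr 1
  ext z
  by_cases h : z ∈ D
  · rw [Set.indicator_of_mem h, Set.indicator_of_mem (by simpa using h)]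
  · rw [Set.indicator_of_notMem h, Set.indicator_of_notMem (by simpa using h)]

lemma cone_iso_aux {V : Set ℂ} (hV : IsOpen V) {M : ℝ} (hM : 0 ≤ M) (hb : ∀ z ∈ V, ‖z‖ < M)
    (hfin : μH[1] (frontier V ∩ cone) ≠ ⊤) {ε κ : ℝ} (hε : 0 < ε) (hκ : 0 < κ) (hκ1 : κ ≤ 1) :
    ENNReal.ofReal (2 * (Real.pi / 3)) *
      volume {z : ℂ | z - ε * ⟨Real.sqrt 3 / 2, 1 / 2⟩ ∈ cone ∧ Metric.ball z (ε / 4) ⊆ V} ≤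
      (ENNReal.ofReal ((1+κ)^2) * μH[1] (frontier V ∩ cone)) ^ 2 := by
  have hδ : 0 < ε / 12 := by positivity
  obtain ⟨g, hg, g0, g1, gz, gI⟩ := mollify hV hfin hδ hκ hκ1
  have h3δ : 3 * (ε / 12) = ε / 4 := by ring
  rw [h3δ] at g1 gz gI
  set v : ℂ := ε * ⟨Real.sqrt 3 / 2, 1 / 2⟩ with hv
  have hnv : ‖v‖ ≤ 2 * ε := by
    rw [hv, norm_mul, Complex.norm_real, Real.norm_of_nonneg hε.le, mul_comm]
    gcongr
    refine (Complex.norm_le_abs_re_add_abs_im _).trans ?_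
    have h3' : Real.sqrt 3 ≤ 2 := by rw [Real.sqrt_le_left (by norm_num)]; norm_num
    have h30 : 0 ≤ Real.sqrt 3 := Real.sqrt_nonneg _
    simp only
    rw [abs_of_nonneg (by positivity), abs_of_nonneg (by positivity)]
    linarith
  set G : ℂ → ℝ := fun z => g (z + v) with hG
  have hGc : ContDiff ℝ 1 G := hg.comp (contDiff_id.add contDiff_const)
  have hGz : ∀ z, M + 3 * ε ≤ ‖z‖ → G z = 0 := by
    intro z hz
    apply gz
    rw [← h3δ]
    apply mollify_ball hb
    have : ‖z‖ ≤ ‖z + v‖ + ‖v‖ := by simpa using norm_sub_le (z + v) v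
    linarith
  have main := cone_ineq hGc (fun z => g0 _) (by positivity) hGz
  set D : Set ℂ := {z | z - v ∈ cone} with hD
  have hDm : MeasurableSet D := (measurable_id.sub_const v) cone_open.measurableSet
  have i1 : ∫ z in cone, ‖fderiv ℝ G z‖ = (∫⁻ z in D, ‖fderiv ℝ g z‖ₑ).toReal := by
    rw [integral_norm_eq_lintegral_enorm]
    · rw [hD, ← lintegral_shift cone cone_open.measurableSet (fun z => ‖fderiv ℝ g z‖ₑ)]
      simp only [hG, fderiv_comp_add_right]
    · exact (hGc.continuous_fderiv one_ne_zero).aestronglyMeasurable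
  have i2 : ∫⁻ z in D, ‖fderiv ℝ g z‖ₑ ≤ ENNReal.ofReal ((1+κ)^2) * μH[1] (frontier V ∩ cone) := by
    apply gI D hDm
    intro x hx y hy
    rw [Metric.mem_ball, dist_eq_norm] at hy
    have := cone_shift hx hε hy
    rw [← hv] at this
    simpa using this
  have hne : ∫⁻ z in D, ‖fderiv ℝ g z‖ₑ ≠ ⊤ := ne_top_of_le_ne_top (ENNReal.mul_ne_top ENNReal.ofReal_ne_top hfin) i2
  have hsupp : HasCompactSupport (fun z => G z ^ 2) := by
    refine HasCompactSupport.of_support_subset_isCompact (isCompact_closedBall (0:ℂ) (M + 3 * ε)) ?_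
    intro z hz
    by_contra h
    apply hz
    simp only [Metric.mem_closedBall, dist_zero_right, not_le] at h
    simp [hGz z h.le]
  have hint : IntegrableOn (fun z => G z ^ 2) cone :=
    ((hGc.continuous.pow 2).integrable_of_hasCompactSupport hsupp).integrableOn
  have i3 : ENNReal.ofReal (∫ z in cone, G z ^ 2) = ∫⁻ z in D, ENNReal.ofReal (g z ^ 2) := by
    rw [ofReal_integral_eq_lintegral_ofReal hint (Filter.Eventually.of_forall fun z => sq_nonneg _), hD,
      ← lintegral_shift cone cone_open.measurableSet]
  have i4 : volume {z : ℂ | z - v ∈ cone ∧ Metric.ball z (ε / 4) ⊆ V} ≤ ∫⁻ z in D, ENNReal.ofReal (g z ^ 2) := by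
    have hm : Measurable (fun z => ENNReal.ofReal (g z ^ 2)) :=
      ENNReal.measurable_ofReal.comp (hg.continuous.pow 2).measurable
    have := mul_meas_ge_le_lintegral (μ := volume.restrict D) hm 1
    rw [one_mul] at this
    refine le_trans ?_ this
    rw [Measure.restrict_apply (measurableSet_le measurable_const hm)]
    refine measure_mono ?_
    rintro z ⟨h1, h2⟩
    refine ⟨?_, h1⟩
    simp [g1 z h2]
  calc _ ≤ ENNReal.ofReal (2 * (Real.pi / 3)) * ENNReal.ofReal (∫ z in cone, G z ^ 2) := by
        rw [i3]; exact mul_le_mul_right i4 _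
    _ = ENNReal.ofReal (2 * (Real.pi / 3) * ∫ z in cone, G z ^ 2) := by
        exact (ENNReal.ofReal_mul (by positivity)).symm
    _ ≤ ENNReal.ofReal ((∫ z in cone, ‖fderiv ℝ G z‖) ^ 2) := ENNReal.ofReal_le_ofReal main
    _ = (∫⁻ z in D, ‖fderiv ℝ g z‖ₑ) ^ 2 := by
        rw [i1, ENNReal.ofReal_pow ENNReal.toReal_nonneg, ENNReal.ofReal_toReal hne]
    _ ≤ _ := by gcongr

lemma le_of_kappa {x y : ENNReal} (h : ∀ κ : ℝ, 0 < κ → κ ≤ 1 → x ≤ ENNReal.ofReal ((1+κ)^4) * y) (hy : y ≠ ⊤) : x ≤ y := by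
  have ht : Filter.Tendsto (fun n : ℕ => ENNReal.ofReal ((1 + 1 / ((n:ℝ) + 1))^4) * y) Filter.atTop (nhds y) := by
    have h1 : Filter.Tendsto (fun n : ℕ => ENNReal.ofReal ((1 + 1 / ((n:ℝ) + 1))^4)) Filter.atTop (nhds 1) := by
      have := ((tendsto_one_div_add_atTop_nhds_zero_nat (𝕜 := ℝ)).const_add 1).pow 4
      simpa using ENNReal.tendsto_ofReal this
    simpa using ENNReal.Tendsto.mul_const h1 (Or.inr hy)
  refine ge_of_tendsto' ht fun n => h _ (by positivity) ?_
  rw [div_le_one (by positivity)]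
  linarith [(Nat.cast_nonneg n : (0:ℝ) ≤ n)]

lemma cone_iso {V : Set ℂ} (hV : IsOpen V) (hVc : V ⊆ cone) (hb : Bornology.IsBounded V) :
    ENNReal.ofReal (2 * (Real.pi / 3)) * volume V ≤ (μH[1] (frontier V ∩ cone)) ^ 2 := by
  by_cases hfin : μH[1] (frontier V ∩ cone) = ⊤
  · rw [hfin]; simp
  obtain ⟨M, hM, hbM⟩ := hb.exists_pos_norm_le
  have hb' : ∀ z ∈ V, ‖z‖ < M + 1 := fun z hz => by linarith [hbM z hz]
  refine le_of_kappa (fun κ hκ hκ1 => ?_) (by simp [hfin])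
  set W : ℕ → Set ℂ := fun n => {z : ℂ | z - ((1 / ((n:ℝ) + 1) : ℝ) : ℂ) * ⟨Real.sqrt 3 / 2, 1 / 2⟩ ∈ cone ∧
    Metric.ball z ((1 / ((n:ℝ) + 1)) / 4) ⊆ V} with hW
  have hmono : Monotone W := by
    intro m n hmn z hz
    have hle : 1 / ((n:ℝ) + 1) ≤ 1 / ((m:ℝ)+1) := Nat.one_div_le_one_div hmn
    refine ⟨?_, (Metric.ball_subset_ball (by linarith)).trans hz.2⟩
    rcases hle.eq_or_lt with h | h
    · have := hz.1
      rw [h]; exact this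
    · have := cone_shift (w := 0) hz.1 (sub_pos.2 h) (by rw [norm_zero]; linarith)
      convert this using 1
      push_cast; ring
  have hun : V = ⋃ n, W n := by
    ext z
    simp only [Set.mem_iUnion]
    constructor
    · intro hz
      have t0 : Filter.Tendsto (fun n : ℕ => 1 / ((n:ℝ) + 1)) Filter.atTop (nhds 0) := tendsto_one_div_add_atTop_nhds_zero_nat
      have t1 : Filter.Tendsto (fun n : ℕ => z - ((1 / ((n:ℝ) + 1) : ℝ) : ℂ) * ⟨Real.sqrt 3 / 2, 1 / 2⟩) Filter.atTop (nhds z) := by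
        have := ((Complex.continuous_ofReal.tendsto 0).comp t0).mul_const (⟨Real.sqrt 3 / 2, 1 / 2⟩ : ℂ)
        simpa using this.const_sub z
      obtain ⟨ρ, hρ, hρV⟩ := Metric.isOpen_iff.1 hV z hz
      have e1 := t1.eventually (cone_open.mem_nhds (hVc hz))
      have e2 := t0.eventually (Iio_mem_nhds hρ)
      obtain ⟨n, h1, h2⟩ := (e1.and e2).exists
      refine ⟨n, h1, (Metric.ball_subset_ball ?_).trans hρV⟩
      have h2' : 1 / ((n:ℝ) + 1) < ρ := h2
      have : 0 < 1 / ((n:ℝ) + 1) := by positivity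
      linarith
    · rintro ⟨n, -, h2⟩
      exact h2 (Metric.mem_ball_self (by positivity))
  rw [hun, hmono.measure_iUnion, ENNReal.mul_iSup, ← hun]
  refine iSup_le fun n => ?_
  refine (cone_iso_aux hV (by positivity) hb' hfin (by positivity) hκ hκ1).trans (le_of_eq ?_)
  rw [mul_pow, ← ENNReal.ofReal_pow (by positivity), ← pow_mul]

end

section
open MeasureTheory

lemma isom_mp {E F : Type*} [NormedAddCommGroup E] [InnerProductSpace ℝ E] [FiniteDimensional ℝ E] [MeasurableSpace E] [BorelSpace E]
    [NormedAddCommGroup F] [InnerProductSpace ℝ F] [FiniteDimensional ℝ F] [MeasurableSpace F] [BorelSpace F]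
    (Φ : E ≃ᵢ F) : MeasurePreserving Φ (volume : Measure E) (volume : Measure F) := by
  have h1 := Φ.toRealLinearIsometryEquiv.measurePreserving
  have h2 := measurePreserving_add_right (volume : Measure F) (Φ 0)
  have := h2.comp h1
  have e : (fun x => x + Φ 0) ∘ Φ.toRealLinearIsometryEquiv = Φ := by
    ext x; simp [IsometryEquiv.toRealLinearIsometryEquiv_apply]
  rwa [e] at this

lemma isom_vol {E F : Type*} [NormedAddCommGroup E] [InnerProductSpace ℝ E] [FiniteDimensional ℝ E] [MeasurableSpace E] [BorelSpace E]
    [NormedAddCommGroup F] [InnerProductSpace ℝ F] [FiniteDimensional ℝ F] [MeasurableSpace F] [BorelSpace F]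
    (Φ : E ≃ᵢ F) (S : Set E) : volume (Φ '' S) = volume S := by
  rw [← (isom_mp Φ).measure_preimage_equiv (f := Φ.toHomeomorph.toMeasurableEquiv)]
  congr 1
  exact Set.preimage_image_eq _ Φ.injective

lemma isom_hm {E F : Type*} [NormedAddCommGroup E] [MeasurableSpace E] [BorelSpace E]
    [NormedAddCommGroup F] [MeasurableSpace F] [BorelSpace F]
    (Φ : E ≃ᵢ F) (S : Set E) : μH[1] (Φ '' S) = μH[1] S :=
  Φ.isometry.hausdorffMeasure_image (Or.inl zero_le_one) S

lemma cone_iso_map (Φ : ℂ ≃ᵢ ℂ) {V : Set ℂ} (hV : IsOpen V) (hVc : V ⊆ Φ ⁻¹' cone) (hb : Bornology.IsBounded V) :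
    ENNReal.ofReal (2 * (Real.pi / 3)) * volume V ≤ (μH[1] (frontier V ∩ Φ ⁻¹' cone)) ^ 2 := by
  have h := cone_iso (V := Φ '' V) (Φ.toHomeomorph.isOpenMap V hV) (by simpa using hVc)
    (Φ.isometry.lipschitz.isBounded_image hb)
  have e : frontier (Φ '' V) ∩ cone = Φ '' (frontier V ∩ Φ ⁻¹' cone) := by
    have := Φ.toHomeomorph.image_frontier V
    simp only [IsometryEquiv.coe_toHomeomorph] at this
    rw [Set.image_inter_preimage, this]
  rwa [isom_vol, e, isom_hm] at h

noncomputable def cr : Circle := ⟨⟨-(1/2), Real.sqrt 3 / 2⟩, by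
  have h3 : Real.sqrt 3 * Real.sqrt 3 = 3 := Real.mul_self_sqrt (by norm_num)
  simp only [Submonoid.unitSphere, Submonoid.mem_mk, Subsemigroup.mem_mk, mem_sphere_iff_norm, sub_zero]
  rw [← sq_eq_sq₀ (norm_nonneg _) zero_le_one, ← Complex.normSq_eq_norm_sq, Complex.normSq_apply]
  nlinarith⟩

noncomputable def rho : ℂ ≃ᵢ ℂ := (rotation cr).toIsometryEquiv.trans (IsometryEquiv.addRight 1)

lemma rho_apply (z : ℂ) : rho z = ⟨-(1/2), Real.sqrt 3 / 2⟩ * z + 1 := by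
  change rotation cr z + 1 = _
  rw [rotation_apply]
  rfl

lemma rho_re (z : ℂ) : (rho z).re = 1 - z.re / 2 - Real.sqrt 3 / 2 * z.im := by
  rw [rho_apply]; simp; ring
lemma rho_im (z : ℂ) : (rho z).im = Real.sqrt 3 / 2 * z.re - z.im / 2 := by
  rw [rho_apply]; simp; ring

lemma rho3 (z : ℂ) : rho (rho (rho z)) = z := by
  have h3 : Real.sqrt 3 * Real.sqrt 3 = 3 := Real.mul_self_sqrt (by norm_num)
  apply Complex.ext
  · simp only [rho_re, rho_im]; linear_combination (3 * z.re / 8 - 1/4 + Real.sqrt 3 * z.im / 8) * h3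
  · simp only [rho_re, rho_im]; linear_combination (3 * z.im / 8 - Real.sqrt 3 * z.re / 8) * h3

def triO : Set ℂ := {z | 0 < z.im ∧ z.im < Real.sqrt 3 * z.re ∧ z.im < Real.sqrt 3 * (1 - z.re)}

lemma triO_open : IsOpen triO :=
  (isOpen_lt continuous_const Complex.continuous_im).inter
    ((isOpen_lt Complex.continuous_im (continuous_const.mul Complex.continuous_re)).inter
    (isOpen_lt Complex.continuous_im (continuous_const.mul (continuous_const.sub Complex.continuous_re))))

lemma triO_convex : Convex ℝ triO := by
  intro x hx y hy a b ha hb hab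
  obtain ⟨x1, x2, x3⟩ := hx
  obtain ⟨y1, y2, y3⟩ := hy
  have h := fun (p q : ℝ) (hp : 0 < p) (hq : 0 < q) => (by
    rcases ha.eq_or_lt with h | h
    · have : b = 1 := by linarith
      subst this; nlinarith
    · have := mul_pos h hp
      have := mul_nonneg hb hq.le
      linarith : 0 < a * p + b * q)
  have h1 := h _ _ x1 y1
  have h2 := h _ _ (sub_pos.2 x2) (sub_pos.2 y2)
  have h3 := h _ _ (sub_pos.2 x3) (sub_pos.2 y3)
  refine ⟨?_, ?_, ?_⟩
  · simpa using h1
  · simp only [Complex.add_im, Complex.add_re, Complex.smul_im, Complex.smul_re, smul_eq_mul]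
    linarith
  · simp only [Complex.add_im, Complex.add_re, Complex.smul_im, Complex.smul_re, smul_eq_mul]
    have : b = 1 - a := by linarith
    subst this
    linarith

lemma triO_bdd : Bornology.IsBounded triO := by
  rw [isBounded_iff_forall_norm_le]
  refine ⟨3, fun z hz => ?_⟩
  obtain ⟨h1, h2, h3⟩ := hz
  have h30 : 0 < Real.sqrt 3 := Real.sqrt_pos.2 (by norm_num)
  have h3' : Real.sqrt 3 ≤ 2 := by rw [Real.sqrt_le_left (by norm_num)]; norm_num
  have a1 : 0 < z.re := by
    by_contra h; push Not at h; nlinarith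
  have a2 : z.re < 1 := by
    by_contra h; push Not at h; nlinarith
  refine (Complex.norm_le_abs_re_add_abs_im _).trans ?_
  rw [abs_of_pos a1, abs_of_pos h1]
  nlinarith

lemma rho_triO (z : ℂ) : rho z ∈ triO ↔ z ∈ triO := by
  have h3 : Real.sqrt 3 * Real.sqrt 3 = 3 := Real.mul_self_sqrt (by norm_num)
  have h30 : 0 < Real.sqrt 3 := Real.sqrt_pos.2 (by norm_num)
  simp only [triO, Set.mem_ofPred_eq, rho_re, rho_im]
  have e1 : Real.sqrt 3 * (1 - z.re / 2 - Real.sqrt 3 / 2 * z.im) = Real.sqrt 3 - Real.sqrt 3 / 2 * z.re - 3/2 * z.im := by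
    linear_combination (- z.im / 2) * h3
  have e2 : Real.sqrt 3 * (1 - (1 - z.re / 2 - Real.sqrt 3 / 2 * z.im)) = Real.sqrt 3 / 2 * z.re + 3/2 * z.im := by
    linear_combination (z.im / 2) * h3
  rw [e1, e2]
  constructor
  · rintro ⟨a, b, c⟩; refine ⟨?_, ?_, ?_⟩ <;> linarith
  · rintro ⟨a, b, c⟩; refine ⟨?_, ?_, ?_⟩ <;> linarith

end

section
open MeasureTheory
open scoped ComplexConjugate

lemma lemmaW1 {g : ℂ → ℝ} (hg : ContDiff ℝ 1 g) {D : Set ℂ} (hD : MeasurableSet D) (hc : Convex ℝ D) :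
    volume {s : ℝ | ∃ a ∈ D, ∃ b ∈ D, g a = 1 ∧ g b = 0 ∧ a.re = s ∧ b.re = s} ≤
      ∫⁻ z in D, ‖fderiv ℝ g z Complex.I‖ₑ := by
  have hDc : Continuous (fderiv ℝ g) := hg.continuous_fderiv one_ne_zero
  have hDI : Continuous (fun z => fderiv ℝ g z Complex.I) := hDc.clm_apply continuous_const
  set H : ℂ → ENNReal := D.indicator (fun z => ‖fderiv ℝ g z Complex.I‖ₑ) with hH
  have hHm : Measurable H := hDI.enorm.measurable.indicator hD
  rw [← lintegral_indicator hD, ← hH]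
  rw [← (Complex.volume_preserving_equiv_real_prod.symm _).lintegral_comp hHm]
  have hHm2 : Measurable fun p => H (Complex.measurableEquivRealProd.symm p) := hHm.comp (MeasurableEquiv.measurable _)
  rw [Measure.volume_eq_prod, lintegral_prod _ hHm2.aemeasurable]
  have hm : Measurable fun x => ∫⁻ y : ℝ, H (Complex.measurableEquivRealProd.symm (x, y)) :=
    hHm2.lintegral_prod_right'
  have := mul_meas_ge_le_lintegral (μ := volume) hm 1
  rw [one_mul] at this
  refine le_trans (measure_mono ?_) this
  rintro s ⟨a, ha, b, hb, ga, gb, as, bs⟩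
  simp only [Set.mem_ofPred_eq]
  set k : ℝ → ℂ := fun y => Complex.measurableEquivRealProd.symm (s, y) with hk
  have hk' : ∀ y, k y = (s:ℂ) + y * Complex.I := by
    intro y; simp [hk, Complex.measurableEquivRealProd]
    apply Complex.ext <;> simp
  have hka : k a.im = a := by rw [hk', ← as, Complex.re_add_im]
  have hkb : k b.im = b := by rw [hk', ← bs, Complex.re_add_im]
  have hkc : Continuous k := by
    have : k = fun y : ℝ => (s:ℂ) + y * Complex.I := funext hk'
    rw [this]; fun_prop
  have hd : ∀ y, HasDerivAt (fun y => g (k y)) (fderiv ℝ g (k y) Complex.I) y := by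
    intro y
    have h1 : HasDerivAt k Complex.I y := by
      have : k = fun y : ℝ => (s:ℂ) + y * Complex.I := funext hk'
      rw [this]
      simpa using ((Complex.ofRealCLM.hasDerivAt (x := y)).mul_const Complex.I).const_add (s:ℂ)
    exact ((hg.differentiable one_ne_zero (k y)).hasFDerivAt).comp_hasDerivAt y h1
  have hcd : Continuous fun y => fderiv ℝ g (k y) Complex.I := hDI.comp hkc
  have hi : ∫ y in b.im..a.im, fderiv ℝ g (k y) Complex.I = 1 := by
    rw [intervalIntegral.integral_eq_sub_of_hasDerivAt (fun y _ => hd y) (hcd.intervalIntegrable _ _), hka, hkb, ga, gb]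
    norm_num
  have hmem : ∀ y ∈ Set.uIoc b.im a.im, k y ∈ D := by
    intro y hy
    have hy' := Set.uIoc_subset_uIcc hy
    rw [← segment_eq_uIcc] at hy'
    obtain ⟨p, q, hp, hq, hpq, rfl⟩ := hy'
    have := hc hb ha hp hq hpq
    convert this using 1
    rw [hk']
    apply Complex.ext
    · simp only [Complex.add_re, Complex.ofReal_re, Complex.mul_re, Complex.I_re, Complex.I_im, Complex.ofReal_im, Complex.smul_re, as, bs, smul_eq_mul]
      linear_combination (-s) * hpq
    · simp
  calc (1:ENNReal) = ‖∫ y in b.im..a.im, fderiv ℝ g (k y) Complex.I‖ₑ := by rw [hi]; simp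
    _ = ‖∫ y in Set.uIoc b.im a.im, fderiv ℝ g (k y) Complex.I‖ₑ := by
        rw [← ofReal_norm, ← ofReal_norm, intervalIntegral.norm_integral_eq_norm_integral_uIoc]
    _ ≤ ∫⁻ y in Set.uIoc b.im a.im, ‖fderiv ℝ g (k y) Complex.I‖ₑ := enorm_integral_le_lintegral_enorm _
    _ = ∫⁻ y in Set.uIoc b.im a.im, H (k y) := by
        refine setLIntegral_congr_fun measurableSet_uIoc fun y hy => ?_
        simp only [hH]
        rw [Set.indicator_of_mem (hmem y hy)]
    _ ≤ _ := setLIntegral_le_lintegral _ _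

lemma lemmaW (u : Circle) {g : ℂ → ℝ} (hg : ContDiff ℝ 1 g) {D : Set ℂ} (hD : MeasurableSet D) (hc : Convex ℝ D) :
    volume {s : ℝ | ∃ a ∈ D, ∃ b ∈ D, g a = 1 ∧ g b = 0 ∧ (conj (u:ℂ) * a).re = s ∧ (conj (u:ℂ) * b).re = s} ≤
      ∫⁻ z in D, ‖fderiv ℝ g z (u * Complex.I)‖ₑ := by
  have hmp : MeasurePreserving (rotation u) := (rotation u).measurePreserving
  set G : ℂ → ℝ := fun z => g (rotation u z) with hG
  have hGc : ContDiff ℝ 1 G := hg.comp (rotation u).contDiff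
  have h1 := lemmaW1 hGc (D := rotation u ⁻¹' D) (hmp.measurable hD)
    (hc.linear_preimage (rotation u).toLinearEquiv.toLinearMap)
  have hDc : Continuous (fderiv ℝ g) := hg.continuous_fderiv one_ne_zero
  have hDI : Continuous (fun z => fderiv ℝ g z (u * Complex.I)) := hDc.clm_apply continuous_const
  have e : ∀ z, fderiv ℝ G z Complex.I = fderiv ℝ g (rotation u z) (u * Complex.I) := by
    intro z
    have : HasFDerivAt G ((fderiv ℝ g (rotation u z)).comp ((rotation u).toContinuousLinearEquiv : ℂ →L[ℝ] ℂ)) z :=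
      ((hg.differentiable one_ne_zero _).hasFDerivAt).comp z (rotation u).toContinuousLinearEquiv.hasFDerivAt
    rw [this.fderiv]
    simp [rotation_apply]
  simp only [e] at h1
  rw [← hmp.setLIntegral_comp_preimage hD hDI.enorm.measurable]
  refine le_trans (measure_mono ?_) h1
  have huu : (u:ℂ) * conj (u:ℂ) = 1 := by rw [Complex.mul_conj, Circle.normSq_coe]; simp
  rintro s ⟨a, ha, b, hb, ga, gb, as, bs⟩
  refine ⟨conj (u:ℂ) * a, ?_, conj (u:ℂ) * b, ?_, ?_, ?_, as, bs⟩
  · simp only [Set.mem_preimage, rotation_apply]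
    rw [← mul_assoc, huu, one_mul]; exact ha
  · simp only [Set.mem_preimage, rotation_apply]
    rw [← mul_assoc, huu, one_mul]; exact hb
  · simp only [hG, rotation_apply]
    rw [← mul_assoc, huu, one_mul]; exact ga
  · simp only [hG, rotation_apply]
    rw [← mul_assoc, huu, one_mul]; exact gb

noncomputable def cw : Circle := ⟨⟨1/2, Real.sqrt 3 / 2⟩, by
  have h3 : Real.sqrt 3 * Real.sqrt 3 = 3 := Real.mul_self_sqrt (by norm_num)
  simp only [Submonoid.unitSphere, Submonoid.mem_mk, Subsemigroup.mem_mk, mem_sphere_iff_norm, sub_zero]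
  rw [← sq_eq_sq₀ (norm_nonneg _) zero_le_one, ← Complex.normSq_eq_norm_sq, Complex.normSq_apply]
  nlinarith⟩

lemma three_dirs (f : ℂ →L[ℝ] ℝ) : ‖f ((1:Circle) * Complex.I)‖ₑ + ‖f (cw * Complex.I)‖ₑ + ‖f (cr * Complex.I)‖ₑ ≤ 2 * ‖f‖ₑ := by
  have hb : ∀ u : Circle, |f (u * Complex.I)| ≤ ‖f‖ := by
    intro u
    have := f.le_opNorm (u * Complex.I)
    simpa [Circle.norm_coe] using this
  have hsum : f (cw * Complex.I) = f ((1:Circle) * Complex.I) + f (cr * Complex.I) := by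
    rw [← map_add]
    congr 1
    rw [← add_mul]
    congr 1
    apply Complex.ext
    · simp [cw, cr]; norm_num
    · simp [cw, cr]
  have a1 := hb 1
  have a2 := hb cw
  have a3 := hb cr
  have h : |f ((1:Circle) * Complex.I)| + |f (cw * Complex.I)| + |f (cr * Complex.I)| ≤ 2 * ‖f‖ := by
    rw [hsum] at a2 ⊢
    revert a1 a2 a3
    generalize f ((1:Circle) * Complex.I) = x
    generalize f (cr * Complex.I) = y
    intro a1 a2 a3
    rcases abs_cases x with h | h <;> rcases abs_cases y with h' | h' <;> rcases abs_cases (x+y) with h'' | h'' <;> linarith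
  simp only [← ofReal_norm, Real.norm_eq_abs]
  rw [← ENNReal.ofReal_add (abs_nonneg _) (abs_nonneg _), ← ENNReal.ofReal_add (by positivity) (abs_nonneg _),
    show (2:ENNReal) = ENNReal.ofReal 2 by simp, ← ENNReal.ofReal_mul (by norm_num)]
  exact ENNReal.ofReal_le_ofReal h

end

section
open MeasureTheory
open scoped ComplexConjugate

noncomputable def pr (u : Circle) (z : ℂ) : ℝ := (conj (u:ℂ) * z).re

lemma inner_convex {Ω : Set ℂ} (hc : Convex ℝ Ω) (r : ℝ) : Convex ℝ {z | Metric.ball z r ⊆ Ω} := by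
  intro x hx y hy a b ha hb hab z hz
  rw [Metric.mem_ball, dist_eq_norm] at hz
  set w := z - (a • x + b • y) with hw
  have h1 : x + w ∈ Ω := hx (by simpa [Metric.mem_ball, dist_eq_norm] using hz)
  have h2 : y + w ∈ Ω := hy (by simpa [Metric.mem_ball, dist_eq_norm] using hz)
  have := hc h1 h2 ha hb hab
  have e : a • (x + w) + b • (y + w) = z := by
    rw [smul_add, smul_add, add_add_add_comm, ← add_smul, hab, one_smul, hw]; ring
  rwa [e] at this

lemma inner_closed (Ω : Set ℂ) (r : ℝ) : IsClosed {z | Metric.ball z r ⊆ Ω} := by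
  rw [← isOpen_compl_iff]
  have : {z | Metric.ball z r ⊆ Ω}ᶜ = ⋃ q ∈ Ωᶜ, Metric.ball q r := by
    ext z
    simp only [Set.mem_compl_iff, Set.mem_ofPred_eq, Set.not_subset, Set.mem_iUnion, Metric.mem_ball]
    constructor
    · rintro ⟨a, h1, h2⟩; exact ⟨a, h2, by rwa [dist_comm]⟩
    · rintro ⟨a, h1, h2⟩; exact ⟨a, by rwa [dist_comm], h1⟩
  rw [this]
  exact isOpen_biUnion fun q _ => Metric.isOpen_ball

lemma frontier_sub {Ω U1 U2 : Set ℂ} (h1 : IsOpen U1) (h2 : IsOpen U2) (hd : Disjoint U1 U2) :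
    frontier U1 ∩ Ω ⊆ Ω \ (U1 ∪ U2) := by
  rintro x ⟨hx, hxΩ⟩
  refine ⟨hxΩ, ?_⟩
  rintro (h | h)
  · rw [h1.frontier_eq] at hx; exact hx.2 h
  · have := hd.symm.closure_right h2
    exact Set.disjoint_left.1 this h (frontier_subset_closure hx)

lemma sum_lemma {Ω U1 U2 : Set ℂ} (hΩc : Convex ℝ Ω) (h1 : IsOpen U1) (h2 : IsOpen U2) (hd : Disjoint U1 U2)
    (s1 : U1 ⊆ Ω) (s2 : U2 ⊆ Ω) (hfin : μH[1] (Ω \ (U1 ∪ U2)) ≠ ⊤) :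
    volume (pr 1 '' U1 ∩ pr 1 '' U2) + volume (pr cw '' U1 ∩ pr cw '' U2) + volume (pr cr '' U1 ∩ pr cr '' U2)
      ≤ 2 * μH[1] (Ω \ (U1 ∪ U2)) := by
  set K := Ω \ (U1 ∪ U2) with hK
  have hfs : frontier U1 ∩ Ω ⊆ K := frontier_sub h1 h2 hd
  have hle : μH[1] (frontier U1 ∩ Ω) ≤ μH[1] K := measure_mono hfs
  have hfin1 : μH[1] (frontier U1 ∩ Ω) ≠ ⊤ := ne_top_of_le_ne_top hfin hle
  refine le_of_kappa (fun κ hκ hκ1 => ?_) (ENNReal.mul_ne_top (by simp) hfin)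
  set A : Circle → ℕ → Set ℝ := fun u n => {s | ∃ a, Metric.ball a (1 / ((n:ℝ)+1)) ⊆ U1 ∧ ∃ b, Metric.ball b (1 / ((n:ℝ)+1)) ⊆ U2 ∧
    pr u a = s ∧ pr u b = s} with hA
  have hmono : ∀ u, Monotone (A u) := by
    intro u m n hmn s hs
    obtain ⟨a, ha, b, hb, e1, e2⟩ := hs
    have hle : 1 / ((n:ℝ) + 1) ≤ 1 / ((m:ℝ)+1) := Nat.one_div_le_one_div hmn
    exact ⟨a, (Metric.ball_subset_ball hle).trans ha, b, (Metric.ball_subset_ball hle).trans hb, e1, e2⟩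
  have hun : ∀ u, pr u '' U1 ∩ pr u '' U2 = ⋃ n, A u n := by
    intro u
    ext s
    simp only [Set.mem_iUnion]
    constructor
    · rintro ⟨⟨a, ha, rfl⟩, ⟨b, hb, hab⟩⟩
      obtain ⟨ρ, hρ, hρV⟩ := Metric.isOpen_iff.1 h1 a ha
      obtain ⟨ρ', hρ', hρV'⟩ := Metric.isOpen_iff.1 h2 b hb
      obtain ⟨n, hn⟩ := exists_nat_one_div_lt (lt_min hρ hρ')
      exact ⟨n, a, (Metric.ball_subset_ball (hn.le.trans (min_le_left _ _))).trans hρV, b,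
        (Metric.ball_subset_ball (hn.le.trans (min_le_right _ _))).trans hρV', rfl, hab⟩
    · rintro ⟨n, a, ha, b, hb, e1, e2⟩
      exact ⟨⟨a, ha (Metric.mem_ball_self (by positivity)), e1⟩, ⟨b, hb (Metric.mem_ball_self (by positivity)), e2⟩⟩
  have ht : ∀ u, Filter.Tendsto (fun n => volume (A u n)) Filter.atTop (nhds (volume (pr u '' U1 ∩ pr u '' U2))) := by
    intro u
    rw [hun]; exact tendsto_measure_iUnion_atTop (hmono u)
  refine le_of_tendsto' (((ht 1).add (ht cw)).add (ht cr)) fun n => ?_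
  set r : ℝ := 1 / ((n:ℝ)+1) with hr
  have hr0 : 0 < r := by positivity
  obtain ⟨g, hg, g0, g1, gz, gI⟩ := mollify h1 hfin1 (δ := r / 3) (by positivity) hκ hκ1
  have h3δ : 3 * (r / 3) = r := by ring
  rw [h3δ] at g1 gz gI
  set D : Set ℂ := {z | Metric.ball z r ⊆ Ω} with hD
  have hDm : MeasurableSet D := (inner_closed Ω r).measurableSet
  have hDc : Continuous (fderiv ℝ g) := hg.continuous_fderiv one_ne_zero
  have hDu : ∀ u : Circle, Measurable (fun z => ‖fderiv ℝ g z (u * Complex.I)‖ₑ) := fun u =>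
    (hDc.clm_apply continuous_const).enorm.measurable
  have hW : ∀ u, volume (A u n) ≤ ∫⁻ z in D, ‖fderiv ℝ g z (u * Complex.I)‖ₑ := by
    intro u
    refine le_trans (measure_mono ?_) (lemmaW u hg hDm (inner_convex hΩc r))
    rintro s ⟨a, ha, b, hb, e1, e2⟩
    exact ⟨a, ha.trans s1, b, hb.trans s2, g1 a ha, gz b (hd.symm.mono_left hb), e1, e2⟩
  calc volume (A 1 n) + volume (A cw n) + volume (A cr n) ≤ _ := add_le_add (add_le_add (hW 1) (hW cw)) (hW cr)
    _ = ∫⁻ z in D, (‖fderiv ℝ g z ((1:Circle) * Complex.I)‖ₑ + ‖fderiv ℝ g z (cw * Complex.I)‖ₑ + ‖fderiv ℝ g z (cr * Complex.I)‖ₑ) := by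
        rw [lintegral_add_right _ (hDu cr), lintegral_add_right _ (hDu cw)]
    _ ≤ ∫⁻ z in D, 2 * ‖fderiv ℝ g z‖ₑ := lintegral_mono fun z => three_dirs _
    _ = 2 * ∫⁻ z in D, ‖fderiv ℝ g z‖ₑ := lintegral_const_mul' _ _ (by simp)
    _ ≤ 2 * (ENNReal.ofReal ((1+κ)^2) * μH[1] (frontier U1 ∩ Ω)) := by
        gcongr
        exact gI D hDm fun x hx => hx
    _ ≤ 2 * (ENNReal.ofReal ((1+κ)^4) * μH[1] K) := by
        gcongr
        · linarith
        · norm_num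
    _ = _ := by ring

end

section
open MeasureTheory
open scoped ComplexConjugate

lemma pr_one (z : ℂ) : pr 1 z = z.re := by simp [pr]
lemma pr_cw (z : ℂ) : pr cw z = z.re / 2 + Real.sqrt 3 / 2 * z.im := by simp [pr, cw]; ring
lemma pr_cr (z : ℂ) : pr cr z = - z.re / 2 + Real.sqrt 3 / 2 * z.im := by simp [pr, cr]; ring

lemma pr_cont (u : Circle) : Continuous (pr u) := by unfold pr; fun_prop

def triC : Set ℂ := {z | 0 ≤ z.im ∧ z.im ≤ Real.sqrt 3 * z.re ∧ z.im ≤ Real.sqrt 3 * (1 - z.re)}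

lemma triC_closed : IsClosed triC :=
  (isClosed_le continuous_const Complex.continuous_im).inter
    ((isClosed_le Complex.continuous_im (continuous_const.mul Complex.continuous_re)).inter
    (isClosed_le Complex.continuous_im (continuous_const.mul (continuous_const.sub Complex.continuous_re))))

lemma triO_sub_triC : triO ⊆ triC := fun _ h => ⟨h.1.le, h.2.1.le, h.2.2.le⟩

lemma reg (Φ : ℂ ≃ᵢ ℂ) {U W R Rc : Set ℂ} (hU : IsOpen U) (hW : IsOpen W) (hd : Disjoint U W)
    (sU : U ⊆ triO) (hR : IsOpen R) (hRc : IsClosed Rc) (hRR : R ⊆ Rc)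
    (hcone : triO ⊆ Φ ⁻¹' cone) (hcl : ∀ x ∈ triC, x ∈ Rc → Φ x ∈ cone → x ∈ triO)
    (hUR : ∀ x ∈ U, x ∈ Rc → x ∈ R) (hN : μH[1] ((triO \ (U ∪ W)) ∩ (Rc \ R)) = 0) :
    ENNReal.ofReal (2 * (Real.pi / 3)) * volume (U ∩ R) ≤ (μH[1] ((triO \ (U ∪ W)) ∩ R)) ^ 2 := by
  refine (cone_iso_map Φ (hU.inter hR) ((Set.inter_subset_left.trans sU).trans hcone)
    (triO_bdd.subset (Set.inter_subset_left.trans sU))).trans ?_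
  refine pow_le_pow_left' ?_ 2
  have hsub : frontier (U ∩ R) ∩ Φ ⁻¹' cone ⊆ ((triO \ (U ∪ W)) ∩ R) ∪ ((triO \ (U ∪ W)) ∩ (Rc \ R)) := by
    rintro x ⟨hx, hxc⟩
    have hxcl := frontier_subset_closure hx
    have hxC : x ∈ triC := closure_minimal ((Set.inter_subset_left.trans sU).trans triO_sub_triC) triC_closed hxcl
    have hxR : x ∈ Rc := closure_minimal (Set.inter_subset_right.trans hRR) hRc hxcl
    have hxO := hcl x hxC hxR hxc
    have hxK : x ∈ triO \ (U ∪ W) := by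
      refine ⟨hxO, ?_⟩
      rintro (h | h)
      · rw [(hU.inter hR).frontier_eq] at hx
        exact hx.2 ⟨h, hUR x h hxR⟩
      · have := (hd.mono_left (Set.inter_subset_left (t := R))).symm.closure_right hW
        exact Set.disjoint_left.1 this h hxcl
    by_cases h : x ∈ R
    · exact Or.inl ⟨hxK, h⟩
    · exact Or.inr ⟨hxK, hxR, h⟩
  refine (measure_mono hsub).trans ((measure_union_le _ _).trans ?_)
  rw [hN, add_zero]

lemma three_regions {U W : Set ℂ} (hU : IsOpen U) (hW : IsOpen W) (hd : Disjoint U W) (sU : U ⊆ triO)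
    {s t : ℝ} (hs : s < 1 / 2) (ht : t < 0) (hst : 0 < s + t)
    (hm : ∀ z ∈ U, pr cw z ≠ s ∧ pr cr z ≠ t)
    (n1 : μH[1] ((triO \ (U ∪ W)) ∩ {z | pr cw z = s}) = 0)
    (n2 : μH[1] ((triO \ (U ∪ W)) ∩ {z | pr cr z = t}) = 0) :
    ENNReal.ofReal (2 * (Real.pi / 3)) * volume U ≤ (μH[1] (triO \ (U ∪ W))) ^ 2 := by
  have h3 : Real.sqrt 3 * Real.sqrt 3 = 3 := Real.mul_self_sqrt (by norm_num)
  have h30 : 0 < Real.sqrt 3 := Real.sqrt_pos.2 (by norm_num)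
  set K := triO \ (U ∪ W) with hK
  have hKm : MeasurableSet K := triO_open.measurableSet.diff (hU.union hW).measurableSet
  have cwc := pr_cont cw
  have crc := pr_cont cr
  set R1 : Set ℂ := {z | pr cw z < s} with hR1
  set R2 : Set ℂ := {z | s < pr cw z ∧ pr cr z < t} with hR2
  set R3 : Set ℂ := {z | s < pr cw z ∧ t < pr cr z} with hR3
  have o1 : IsOpen R1 := isOpen_lt cwc continuous_const
  have o2 : IsOpen R2 := (isOpen_lt continuous_const cwc).inter (isOpen_lt crc continuous_const)
  have o3 : IsOpen R3 := (isOpen_lt continuous_const cwc).inter (isOpen_lt continuous_const crc)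
  have hnull : ∀ S : Set ℂ, S ⊆ {z | pr cw z = s} ∪ {z | pr cr z = t} → μH[1] (K ∩ S) = 0 := by
    intro S hS
    refine measure_mono_null (t := (K ∩ {z | pr cw z = s}) ∪ (K ∩ {z | pr cr z = t})) ?_ (measure_union_null n1 n2)
    rintro x ⟨h1, h2⟩
    rcases hS h2 with h | h
    · exact Or.inl ⟨h1, h⟩
    · exact Or.inr ⟨h1, h⟩
  have b1 : ENNReal.ofReal (2 * (Real.pi / 3)) * volume (U ∩ R1) ≤ (μH[1] (K ∩ R1)) ^ 2 := by
    refine reg (IsometryEquiv.refl ℂ) (Rc := {z | pr cw z ≤ s}) hU hW hd sU o1 (isClosed_le cwc continuous_const)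
      (fun z (hz : pr cw z < s) => (hz.le : pr cw z ≤ s)) (fun z hz => ⟨hz.1, hz.2.1⟩) ?_ (fun z hz h => lt_of_le_of_ne h (hm z hz).1) (hnull _ ?_)
    · rintro z ⟨a1, a2, a3⟩ hz hc
      have hz' : pr cw z ≤ s := hz
      rw [pr_cw] at hz'
      obtain ⟨c1, c2⟩ : z ∈ cone := hc
      refine ⟨c1, c2, lt_of_le_of_ne a3 fun h => ?_⟩
      rw [h] at hz'
      nlinarith
    · rintro z ⟨x1, x2⟩
      left
      exact le_antisymm x1 (not_lt.1 x2)
  have b2 : ENNReal.ofReal (2 * (Real.pi / 3)) * volume (U ∩ R2) ≤ (μH[1] (K ∩ R2)) ^ 2 := by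
    refine reg (rho.trans rho) (Rc := {z | s ≤ pr cw z ∧ pr cr z ≤ t}) hU hW hd sU o2
      ((isClosed_le continuous_const cwc).inter (isClosed_le crc continuous_const))
      (fun z hz => ⟨le_of_lt hz.1, le_of_lt hz.2⟩) ?_ ?_
      (fun z hz h => ⟨lt_of_le_of_ne h.1 (hm z hz).1.symm, lt_of_le_of_ne h.2 (hm z hz).2⟩) (hnull _ ?_)
    · rintro z ⟨a1, a2, a3⟩
      change rho (rho z) ∈ cone
      simp only [cone, Set.mem_ofPred_eq, rho_re, rho_im]
      constructor <;> nlinarith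
    · rintro z ⟨a1, a2, a3⟩ ⟨hz1, hz2⟩ hc
      change rho (rho z) ∈ cone at hc
      simp only [cone, Set.mem_ofPred_eq, rho_re, rho_im] at hc
      rw [pr_cr] at hz2
      obtain ⟨c1, c2⟩ := hc
      have c1' : z.im < Real.sqrt 3 * (1 - z.re) := by nlinarith
      have c2' : 0 < z.im := by nlinarith
      refine ⟨c2', lt_of_le_of_ne a2 fun h => ?_, c1'⟩
      rw [h] at hz2
      nlinarith
    · rintro z ⟨⟨x1, x1'⟩, x2⟩
      by_contra hcon
      simp only [Set.mem_union, Set.mem_ofPred_eq, not_or] at hcon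
      exact x2 ⟨lt_of_le_of_ne x1 (Ne.symm hcon.1), lt_of_le_of_ne x1' hcon.2⟩
  have b3 : ENNReal.ofReal (2 * (Real.pi / 3)) * volume (U ∩ R3) ≤ (μH[1] (K ∩ R3)) ^ 2 := by
    refine reg rho (Rc := {z | s ≤ pr cw z ∧ t ≤ pr cr z}) hU hW hd sU o3
      ((isClosed_le continuous_const cwc).inter (isClosed_le continuous_const crc))
      (fun z hz => ⟨le_of_lt hz.1, le_of_lt hz.2⟩) ?_ ?_
      (fun z hz h => ⟨lt_of_le_of_ne h.1 (hm z hz).1.symm, lt_of_le_of_ne h.2 (hm z hz).2.symm⟩) (hnull _ ?_)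
    · rintro z ⟨a1, a2, a3⟩
      simp only [cone, Set.mem_preimage, Set.mem_ofPred_eq, rho_re, rho_im]
      constructor <;> nlinarith
    · rintro z ⟨a1, a2, a3⟩ ⟨hz1, hz2⟩ hc
      simp only [cone, Set.mem_ofPred_eq, rho_re, rho_im] at hc
      rw [pr_cr] at hz2
      rw [pr_cw] at hz1
      obtain ⟨c1, c2⟩ := hc
      have c1' : z.im < Real.sqrt 3 * (1 - z.re) := by nlinarith
      have c2' : z.im < Real.sqrt 3 * z.re := by nlinarith
      refine ⟨lt_of_le_of_ne a1 fun h => ?_, c2', c1'⟩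
      rw [← h] at hz1 hz2
      linarith
    · rintro z ⟨⟨x1, x1'⟩, x2⟩
      by_contra hcon
      simp only [Set.mem_union, Set.mem_ofPred_eq, not_or] at hcon
      exact x2 ⟨lt_of_le_of_ne x1 (Ne.symm hcon.1), lt_of_le_of_ne x1' (Ne.symm hcon.2)⟩
  have hvol : volume U ≤ volume (U ∩ R1) + volume (U ∩ R2) + volume (U ∩ R3) := by
    refine le_trans (measure_mono (t := (U ∩ R1) ∪ (U ∩ R2) ∪ (U ∩ R3)) ?_)
      ((measure_union_le _ _).trans (add_le_add_left (measure_union_le _ _) _))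
    intro z hz
    obtain ⟨m1, m2⟩ := hm z hz
    rcases lt_or_gt_of_ne m1 with h | h
    · exact Or.inl (Or.inl ⟨hz, h⟩)
    · rcases lt_or_gt_of_ne m2 with h' | h'
      · exact Or.inl (Or.inr ⟨hz, h, h'⟩)
      · exact Or.inr ⟨hz, h, h'⟩
  have hH : μH[1] (K ∩ R1) + μH[1] (K ∩ R2) + μH[1] (K ∩ R3) ≤ μH[1] K := by
    rw [← measure_union _ (hKm.inter o2.measurableSet), ← measure_union _ (hKm.inter o3.measurableSet)]
    · refine measure_mono ?_
      rintro x ((h | h) | h) <;> exact h.1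
    · rw [Set.disjoint_left]
      rintro x (h | h) h'
      · exact lt_asymm (show pr cw x < s from h.2) h'.2.1
      · exact lt_asymm h.2.2 h'.2.2
    · rw [Set.disjoint_left]
      rintro x h h'
      exact lt_asymm (show pr cw x < s from h.2) h'.2.1
  calc _ ≤ ENNReal.ofReal (2 * (Real.pi / 3)) * (volume (U ∩ R1) + volume (U ∩ R2) + volume (U ∩ R3)) := mul_le_mul_right hvol _
    _ ≤ (μH[1] (K ∩ R1)) ^ 2 + (μH[1] (K ∩ R2)) ^ 2 + (μH[1] (K ∩ R3)) ^ 2 := by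
        rw [mul_add, mul_add]
        exact add_le_add (add_le_add b1 b2) b3
    _ ≤ (μH[1] (K ∩ R1) + μH[1] (K ∩ R2) + μH[1] (K ∩ R3)) ^ 2 := by
        generalize μH[1] (K ∩ R1) = a
        generalize μH[1] (K ∩ R2) = b
        generalize μH[1] (K ∩ R3) = c
        have : (a + b + c) ^ 2 = (a ^ 2 + b ^ 2 + c ^ 2) + (2 * a * b + 2 * a * c + 2 * b * c) := by ring
        rw [this]; exact le_self_add
    _ ≤ _ := by gcongr

end

section
open MeasureTheory
open scoped ComplexConjugate

lemma pick {A N I J : Set ℝ} (hIJ : I ⊆ J) (hN : volume N = 0) (h : volume (A ∩ J) < volume I) :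
    ∃ s ∈ I, s ∉ A ∧ s ∉ N := by
  by_contra hcon
  push Not at hcon
  have : I ⊆ (A ∩ J) ∪ N := by
    intro s hs
    by_cases hA : s ∈ A
    · exact Or.inl ⟨hA, hIJ hs⟩
    · exact Or.inr (hcon s hs hA)
  have h2 := (measure_mono this).trans (measure_union_le (μ := volume) _ _)
  rw [hN, add_zero] at h2
  exact absurd h (not_lt.2 h2)

lemma pr_lip (u : Circle) : LipschitzWith 1 (pr u) := by
  refine LipschitzWith.of_dist_le_mul fun x y => ?_
  rw [Real.dist_eq, dist_eq_norm, NNReal.coe_one, one_mul]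
  unfold pr
  rw [← Complex.sub_re, ← mul_sub]
  refine (Complex.abs_re_le_norm _).trans ?_
  rw [norm_mul, Complex.norm_conj, Circle.norm_coe, one_mul]

lemma base {U1 U2 : Set ℂ} (h1 : IsOpen U1) (h2 : IsOpen U2) (hd : Disjoint U1 U2)
    (s1 : U1 ⊆ triO) (s2 : U2 ⊆ triO) (hfin : μH[1] (triO \ (U1 ∪ U2)) ≠ ⊤)
    (hb : volume ((pr cw '' U1 ∩ pr cw '' U2) ∩ Set.Ioo 0 (1/2)) +
      volume ((pr cr '' U1 ∩ pr cr '' U2) ∩ Set.Ioo (-(1/2)) 0) < ENNReal.ofReal (1/2)) :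
    ENNReal.ofReal (2 * (Real.pi / 3)) * volume U1 ≤ (μH[1] (triO \ (U1 ∪ U2))) ^ 2 ∨
    ENNReal.ofReal (2 * (Real.pi / 3)) * volume U2 ≤ (μH[1] (triO \ (U1 ∪ U2))) ^ 2 := by
  have h3 : Real.sqrt 3 * Real.sqrt 3 = 3 := Real.mul_self_sqrt (by norm_num)
  have h30 : 0 < Real.sqrt 3 := Real.sqrt_pos.2 (by norm_num)
  set K := triO \ (U1 ∪ U2) with hK
  set A := pr cw '' U1 ∩ pr cw '' U2 with hA
  set B := pr cr '' U1 ∩ pr cr '' U2 with hB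
  haveI : IsFiniteMeasure ((μH[1] : Measure ℂ).restrict K) := ⟨by
    rw [Measure.restrict_apply_univ]; exact hfin.lt_top⟩
  have fa : volume (A ∩ Set.Ioo 0 (1/2)) ≠ ⊤ := ne_top_of_lt (lt_of_le_of_lt le_self_add hb)
  have fb : volume (B ∩ Set.Ioo (-(1/2)) 0) ≠ ⊤ := ne_top_of_lt (lt_of_le_of_lt le_add_self hb)
  obtain ⟨a, ha⟩ : ∃ a, a = (volume (A ∩ Set.Ioo 0 (1/2))).toReal := ⟨_, rfl⟩
  obtain ⟨b, hb'⟩ : ∃ b, b = (volume (B ∩ Set.Ioo (-(1/2)) 0)).toReal := ⟨_, rfl⟩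
  have ha0 : 0 ≤ a := ha ▸ ENNReal.toReal_nonneg
  have hb0 : 0 ≤ b := hb' ▸ ENNReal.toReal_nonneg
  have hae : volume (A ∩ Set.Ioo 0 (1/2)) = ENNReal.ofReal a := by rw [ha, ENNReal.ofReal_toReal fa]
  have hbe : volume (B ∩ Set.Ioo (-(1/2)) 0) = ENNReal.ofReal b := by rw [hb', ENNReal.ofReal_toReal fb]
  have hab : a + b < 1 / 2 := by
    rw [hae, hbe, ← ENNReal.ofReal_add ha0 hb0] at hb
    exact (ENNReal.ofReal_lt_ofReal_iff (by norm_num)).1 hb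
  obtain ⟨η, hη, hη2⟩ : ∃ η : ℝ, 0 < η ∧ a + b + 2 * η < 1 / 2 := ⟨(1/2 - a - b)/4, by linarith, by linarith⟩
  have cnt : ∀ u, volume {t : ℝ | 0 < ((μH[1] : Measure ℂ).restrict K) {z | pr u z = t}} = 0 := fun u =>
    (Measure.countable_meas_level_set_pos (pr_cont u).measurable).measure_zero _
  have lev : ∀ u (s : ℝ), s ∉ {t : ℝ | 0 < ((μH[1] : Measure ℂ).restrict K) {z | pr u z = t}} →
      μH[1] (K ∩ {z | pr u z = s}) = 0 := by
    intro u s hs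
    simp only [Set.mem_ofPred_eq, not_lt, nonpos_iff_eq_zero] at hs
    rwa [Measure.restrict_apply ((isClosed_eq (pr_cont u) continuous_const).measurableSet), Set.inter_comm] at hs
  obtain ⟨s, hsI, hsA, hsN⟩ := pick (A := A) (I := Set.Ioo (1/2 - a - η) (1/2)) (J := Set.Ioo 0 (1/2))
    (Set.Ioo_subset_Ioo (by linarith) le_rfl) (cnt cw) (by
      rw [hae, Real.volume_Ioo]; exact (ENNReal.ofReal_lt_ofReal_iff (by linarith)).2 (by linarith))
  have n1 := lev cw s hsN
  have hnull : volume (pr cr '' (K ∩ {z | pr cw z = s})) = 0 := by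
    have := (pr_lip cr).hausdorffMeasure_image_le zero_le_one (K ∩ {z | pr cw z = s})
    rw [n1, mul_zero, hausdorffMeasure_real] at this
    exact le_antisymm this zero_le
  obtain ⟨t, htI, htB, htN⟩ := pick (A := B) (I := Set.Ioo (- b - η) 0) (J := Set.Ioo (-(1/2)) 0)
    (Set.Ioo_subset_Ioo (by linarith) le_rfl) (measure_union_null (cnt cr) hnull) (by
      rw [hbe, Real.volume_Ioo]; exact (ENNReal.ofReal_lt_ofReal_iff (by linarith)).2 (by linarith))
  have n2 := lev cr t (fun h => htN (Or.inl h))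
  have hst : 0 < s + t := by linarith [hsI.1, htI.1]
  have hs2 := hsI.2
  have ht2 := htI.2
  obtain ⟨p, hpre, hpim⟩ : ∃ p : ℂ, p.re = s - t ∧ Real.sqrt 3 * p.im = s + t :=
    ⟨⟨s - t, (s + t) / Real.sqrt 3⟩, rfl, by simp; field_simp⟩
  have p1 : pr cw p = s := by rw [pr_cw]; linarith
  have p2 : pr cr p = t := by rw [pr_cr]; linarith
  have pO : p ∈ triO := by
    refine ⟨?_, ?_, ?_⟩
    · by_contra h; push Not at h; nlinarith
    · have : Real.sqrt 3 * p.im < Real.sqrt 3 * (Real.sqrt 3 * p.re) := by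
        rw [← mul_assoc, h3]; linarith
      exact lt_of_mul_lt_mul_left this h30.le
    · have : Real.sqrt 3 * p.im < Real.sqrt 3 * (Real.sqrt 3 * (1 - p.re)) := by
        rw [← mul_assoc, h3]; linarith
      exact lt_of_mul_lt_mul_left this h30.le
  have pK : p ∉ K := fun h => htN (Or.inr ⟨p, ⟨h, p1⟩, p2⟩)
  have pU : p ∈ U1 ∪ U2 := by
    by_contra h; exact pK ⟨pO, h⟩
  rcases pU with hp | hp
  · right
    have e : K = triO \ (U2 ∪ U1) := by rw [hK, Set.union_comm]
    rw [e] at n1 n2 ⊢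
    refine three_regions h2 h1 hd.symm s2 hs2 ht2 hst ?_ n1 n2
    intro z hz
    exact ⟨fun h => hsA ⟨⟨p, hp, p1⟩, ⟨z, hz, h⟩⟩, fun h => htB ⟨⟨p, hp, p2⟩, ⟨z, hz, h⟩⟩⟩
  · left
    refine three_regions h1 h2 hd s1 hs2 ht2 hst ?_ n1 n2
    intro z hz
    exact ⟨fun h => hsA ⟨⟨z, hz, h⟩, ⟨p, hp, p1⟩⟩, fun h => htB ⟨⟨z, hz, h⟩, ⟨p, hp, p2⟩⟩⟩

end

section
open MeasureTheory

lemma volA {U1 U2 : Set ℂ} (f : ℝ ≃ᵢ ℝ) {p p' : ℂ → ℝ} (hp : ∀ z, p (rho z) = f (p' z)) {I J : Set ℝ}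
    (hI : ∀ x, f x ∈ I ↔ x ∈ J) :
    volume ((p '' (rho '' U1) ∩ p '' (rho '' U2)) ∩ I) = volume ((p' '' U1 ∩ p' '' U2) ∩ J) := by
  rw [← isom_vol f ((p' '' U1 ∩ p' '' U2) ∩ J)]
  congr 1
  have h : ∀ U : Set ℂ, p '' (rho '' U) = f '' (p' '' U) := by
    intro U
    rw [Set.image_image, Set.image_image]
    simp only [hp]
  have hJ : J = f ⁻¹' I := by ext x; exact (hI x).symm
  rw [h, h, ← Set.image_inter f.injective, hJ, Set.image_inter_preimage]

lemma rho_cw (z : ℂ) : pr cw (rho z) = IsometryEquiv.subLeft (1/2) (pr cr z) := by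
  have h3 : Real.sqrt 3 * Real.sqrt 3 = 3 := Real.mul_self_sqrt (by norm_num)
  rw [pr_cw, rho_re, rho_im, pr_cr]
  simp only [IsometryEquiv.subLeft_apply]
  linear_combination (z.re / 4) * h3

lemma rho_cr (z : ℂ) : pr cr (rho z) = IsometryEquiv.subRight (1/2) (pr 1 z) := by
  have h3 : Real.sqrt 3 * Real.sqrt 3 = 3 := Real.mul_self_sqrt (by norm_num)
  rw [pr_cr, rho_re, rho_im, pr_one]
  simp only [IsometryEquiv.subRight_apply]
  linear_combination (z.re / 4) * h3

lemma rho_one (z : ℂ) : pr 1 (rho z) = IsometryEquiv.subLeft 1 (pr cw z) := by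
  rw [pr_one, rho_re, pr_cw]
  simp only [IsometryEquiv.subLeft_apply]
  ring

lemma half_half {A I J : Set ℝ} (hI : MeasurableSet I) (h : Disjoint I J) :
    volume (A ∩ I) + volume (A ∩ J) ≤ volume A := by
  rw [← measure_inter_add_sdiff A hI]
  gcongr
  rintro x ⟨h1, h2⟩
  exact ⟨h1, fun h3 => Set.disjoint_left.1 h h3 h2⟩

lemma rho_K (U1 U2 : Set ℂ) : triO \ (rho '' U1 ∪ rho '' U2) = rho '' (triO \ (U1 ∪ U2)) := by
  have : triO = rho '' triO := by
    ext z
    constructor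
    · intro h
      refine ⟨rho (rho z), ?_, rho3 z⟩
      rwa [rho_triO, rho_triO]
    · rintro ⟨y, hy, rfl⟩; rwa [rho_triO]
  conv_lhs => rw [this]
  rw [← Set.image_union, Set.image_sdiff rho.injective]

lemma lower {U1 U2 : Set ℂ} (h1 : IsOpen U1) (h2 : IsOpen U2) (hd : Disjoint U1 U2)
    (s1 : U1 ⊆ triO) (s2 : U2 ⊆ triO)
    (v1 : volume U1 = ENNReal.ofReal (Real.sqrt 3 / 4 / 2)) (v2 : volume U2 = ENNReal.ofReal (Real.sqrt 3 / 4 / 2)) :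
    ENNReal.ofReal (Real.sqrt 3 * Real.pi / 12) ≤ (μH[1] (triO \ (U1 ∪ U2))) ^ 2 := by
  have h30 : 0 < Real.sqrt 3 := Real.sqrt_pos.2 (by norm_num)
  have hpi := Real.pi_pos
  set K := triO \ (U1 ∪ U2) with hK
  have hv : ENNReal.ofReal (Real.sqrt 3 * Real.pi / 12) = ENNReal.ofReal (2 * (Real.pi / 3)) * ENNReal.ofReal (Real.sqrt 3 / 4 / 2) := by
    rw [← ENNReal.ofReal_mul (by positivity)]; congr 1; ring
  by_cases hbig : ENNReal.ofReal (3/4) ≤ μH[1] K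
  · refine le_trans ?_ (pow_le_pow_left' hbig 2)
    rw [← ENNReal.ofReal_pow (by norm_num)]
    apply ENNReal.ofReal_le_ofReal
    have a1 : Real.sqrt 3 ≤ 1.7321 := by rw [Real.sqrt_le_left (by norm_num)]; norm_num
    have a2 := Real.pi_lt_d4
    nlinarith
  push Not at hbig
  have hfin : μH[1] K ≠ ⊤ := ne_top_of_lt hbig
  have himg : ∀ {V1 V2 : Set ℂ}, IsOpen V1 → IsOpen V2 → Disjoint V1 V2 → V1 ⊆ triO → V2 ⊆ triO →
      IsOpen (rho '' V1) ∧ IsOpen (rho '' V2) ∧ Disjoint (rho '' V1) (rho '' V2) ∧ rho '' V1 ⊆ triO ∧ rho '' V2 ⊆ triO := by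
    intro V1 V2 a1 a2 a3 a4 a5
    refine ⟨rho.toHomeomorph.isOpenMap _ a1, rho.toHomeomorph.isOpenMap _ a2,
      (Set.disjoint_image_iff rho.injective).2 a3, ?_, ?_⟩
    · rintro _ ⟨y, hy, rfl⟩; rw [rho_triO]; exact a4 hy
    · rintro _ ⟨y, hy, rfl⟩; rw [rho_triO]; exact a5 hy
  obtain ⟨p1, p2, p3, p4, p5⟩ := himg h1 h2 hd s1 s2
  obtain ⟨q1, q2, q3, q4, q5⟩ := himg p1 p2 p3 p4 p5
  have k1 : μH[1] (triO \ (rho '' U1 ∪ rho '' U2)) = μH[1] K := by rw [rho_K, isom_hm]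
  have k2 : μH[1] (triO \ (rho '' (rho '' U1) ∪ rho '' (rho '' U2))) = μH[1] K := by rw [rho_K, isom_hm, k1]
  have B0 := base h1 h2 hd s1 s2 hfin
  have B1 := base p1 p2 p3 p4 p5 (by rwa [k1])
  have B2 := base q1 q2 q3 q4 q5 (by rwa [k2])
  rw [← hK, v1, v2, ← hv, or_self] at B0
  have E1 := volA (U1 := U1) (U2 := U2) (IsometryEquiv.subLeft (1/2)) rho_cw (I := Set.Ioo 0 (1/2)) (J := Set.Ioo 0 (1/2)) (by
    intro x; simp only [IsometryEquiv.subLeft_apply, Set.mem_Ioo]; constructor <;> (rintro ⟨a, b⟩; constructor <;> linarith))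
  have E2 := volA (U1 := U1) (U2 := U2) (IsometryEquiv.subRight (1/2)) rho_cr (I := Set.Ioo (-(1/2)) 0) (J := Set.Ioo 0 (1/2)) (by
    intro x; simp only [IsometryEquiv.subRight_apply, Set.mem_Ioo]; constructor <;> (rintro ⟨a, b⟩; constructor <;> linarith))
  have E3 := volA (U1 := rho '' U1) (U2 := rho '' U2) (IsometryEquiv.subLeft (1/2)) rho_cw (I := Set.Ioo 0 (1/2)) (J := Set.Ioo 0 (1/2)) (by
    intro x; simp only [IsometryEquiv.subLeft_apply, Set.mem_Ioo]; constructor <;> (rintro ⟨a, b⟩; constructor <;> linarith))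
  have E4 := volA (U1 := rho '' U1) (U2 := rho '' U2) (IsometryEquiv.subRight (1/2)) rho_cr (I := Set.Ioo (-(1/2)) 0) (J := Set.Ioo 0 (1/2)) (by
    intro x; simp only [IsometryEquiv.subRight_apply, Set.mem_Ioo]; constructor <;> (rintro ⟨a, b⟩; constructor <;> linarith))
  have E5 := volA (U1 := U1) (U2 := U2) (IsometryEquiv.subRight (1/2)) rho_cr (I := Set.Ioo 0 (1/2)) (J := Set.Ioo (1/2) 1) (by
    intro x; simp only [IsometryEquiv.subRight_apply, Set.mem_Ioo]; constructor <;> (rintro ⟨a, b⟩; constructor <;> linarith))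
  have E6 := volA (U1 := U1) (U2 := U2) (IsometryEquiv.subLeft 1) rho_one (I := Set.Ioo 0 (1/2)) (J := Set.Ioo (1/2) 1) (by
    intro x; simp only [IsometryEquiv.subLeft_apply, Set.mem_Ioo]; constructor <;> (rintro ⟨a, b⟩; constructor <;> linarith))
  rw [k1, isom_vol, isom_vol, v1, v2, ← hv, or_self, E1, E2] at B1
  rw [k2, isom_vol, isom_vol, isom_vol, isom_vol, v1, v2, ← hv, or_self, E3, E4, E5, E6] at B2
  by_contra hcon
  have c0 := not_lt.1 (fun h => hcon (B0 h))
  have c1 := not_lt.1 (fun h => hcon (B1 h))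
  have c2 := not_lt.1 (fun h => hcon (B2 h))
  have S := sum_lemma triO_convex h1 h2 hd s1 s2 hfin
  set A1 := pr 1 '' U1 ∩ pr 1 '' U2
  set A2 := pr cw '' U1 ∩ pr cw '' U2
  set A3 := pr cr '' U1 ∩ pr cr '' U2
  have d1 := half_half (A := A1) (I := Set.Ioo 0 (1/2)) (J := Set.Ioo (1/2) 1) measurableSet_Ioo
    (by rw [Set.disjoint_left]; intro x hx hy; linarith [hx.2, hy.1])
  have d2 := half_half (A := A2) (I := Set.Ioo 0 (1/2)) (J := Set.Ioo (1/2) 1) measurableSet_Ioo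
    (by rw [Set.disjoint_left]; intro x hx hy; linarith [hx.2, hy.1])
  have d3 := half_half (A := A3) (I := Set.Ioo (-(1/2)) 0) (J := Set.Ioo 0 (1/2)) measurableSet_Ioo
    (by rw [Set.disjoint_left]; intro x hx hy; linarith [hx.2, hy.1])
  have e1 : ENNReal.ofReal (1/2) + ENNReal.ofReal (1/2) + ENNReal.ofReal (1/2) ≤ 2 * μH[1] K := by
    refine (add_le_add (add_le_add c0 c1) c2).trans (le_trans (le_of_eq ?_) ((add_le_add (add_le_add d1 d2) d3).trans S))
    ring
  have e2 : 2 * μH[1] K < 2 * ENNReal.ofReal (3/4) := (ENNReal.mul_lt_mul_iff_right (by simp) (by simp)).2 hbig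
  have e3 : 2 * ENNReal.ofReal (3/4) = ENNReal.ofReal (1/2) + ENNReal.ofReal (1/2) + ENNReal.ofReal (1/2) := by
    rw [← ENNReal.ofReal_add (by norm_num) (by norm_num), ← ENNReal.ofReal_add (by norm_num) (by norm_num),
      show (2:ENNReal) = ENNReal.ofReal 2 by simp, ← ENNReal.ofReal_mul (by norm_num)]
    congr 1; norm_num
  rw [e3] at e2
  exact absurd e1 (not_le.2 e2)

end

section
open MeasureTheory

lemma triC_interior : interior triC = triO := by
  apply Set.Subset.antisymm
  · intro z hz
    have key : ∀ v : ℂ, ∃ t : ℝ, 0 < t ∧ z + t * v ∈ triC := by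
      intro v
      have hc : Continuous (fun t : ℝ => z + t * v) := by fun_prop
      have h0 : Filter.Tendsto (fun t : ℝ => z + t * v) (nhdsWithin 0 (Set.Ioi 0)) (nhds z) := by
        have := hc.tendsto 0
        simp only [Complex.ofReal_zero, zero_mul, add_zero] at this
        exact this.mono_left nhdsWithin_le_nhds
      obtain ⟨t, ht, ht'⟩ := ((h0.eventually (mem_interior_iff_mem_nhds.1 hz)).and self_mem_nhdsWithin).exists
      exact ⟨t, ht', ht⟩
    obtain ⟨t, ht, a1, a2, a3⟩ := key (-Complex.I)
    obtain ⟨s, hs, b1, b2, b3⟩ := key Complex.I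
    simp at a1 a2 a3 b1 b2 b3
    exact ⟨by linarith, by linarith, by linarith⟩
  · exact interior_maximal triO_sub_triC triO_open

lemma triC_convex : Convex ℝ triC := by
  intro x hx y hy a b ha hb hab
  obtain ⟨x1, x2, x3⟩ := hx
  obtain ⟨y1, y2, y3⟩ := hy
  simp only [triC, Set.mem_ofPred_eq, Complex.add_re, Complex.add_im, Complex.real_smul, Complex.re_ofReal_mul, Complex.im_ofReal_mul]
  refine ⟨by positivity, ?_, ?_⟩
  · nlinarith [mul_le_mul_of_nonneg_left x2 ha, mul_le_mul_of_nonneg_left y2 hb]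
  · have e : Real.sqrt 3 * (1 - (a * x.re + b * y.re)) = a * (Real.sqrt 3 * (1 - x.re)) + b * (Real.sqrt 3 * (1 - y.re)) := by
      linear_combination (- Real.sqrt 3) * hab
    rw [e]
    exact add_le_add (mul_le_mul_of_nonneg_left x3 ha) (mul_le_mul_of_nonneg_left y3 hb)

lemma triC_hull : convexHull ℝ {(0:ℂ), 1, ⟨1/2, Real.sqrt 3 / 2⟩} = triC := by
  have h30 : 0 < Real.sqrt 3 := Real.sqrt_pos.2 (by norm_num)
  have h3 : Real.sqrt 3 * Real.sqrt 3 = 3 := Real.mul_self_sqrt (by norm_num)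
  apply Set.Subset.antisymm
  · apply convexHull_min _ triC_convex
    rintro z (rfl | rfl | rfl)
    · simp [triC]
    · simp [triC]
    · refine ⟨?_, ?_, ?_⟩ <;> simp only <;> nlinarith
  · intro z hz
    obtain ⟨z1, z2, z3⟩ := hz
    set S : Set ℂ := {(0:ℂ), 1, ⟨1/2, Real.sqrt 3 / 2⟩}
    have hc := convex_convexHull ℝ S
    have m0 : (0:ℂ) ∈ convexHull ℝ S := subset_convexHull ℝ S (by simp [S])
    have m1 : (1:ℂ) ∈ convexHull ℝ S := subset_convexHull ℝ S (by simp [S])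
    have m2 : (⟨1/2, Real.sqrt 3 / 2⟩:ℂ) ∈ convexHull ℝ S := subset_convexHull ℝ S (by simp [S])
    have := hc.sum_mem (t := Finset.univ) (w := ![1 - z.re - z.im / Real.sqrt 3, z.re - z.im / Real.sqrt 3, 2 * z.im / Real.sqrt 3])
      (z := ![(0:ℂ), 1, ⟨1/2, Real.sqrt 3 / 2⟩]) (by
        intro i _
        fin_cases i
        · show 0 ≤ 1 - z.re - z.im / Real.sqrt 3
          rw [sub_nonneg, div_le_iff₀ h30]; linarith
        · show 0 ≤ z.re - z.im / Real.sqrt 3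
          rw [sub_nonneg, div_le_iff₀ h30]; linarith
        · show 0 ≤ 2 * z.im / Real.sqrt 3
          positivity) (by
        simp [Fin.sum_univ_three]; ring) (by
        intro i _
        fin_cases i
        · exact m0
        · exact m1
        · exact m2)
    convert this using 1
    simp only [Fin.sum_univ_three, Matrix.cons_val_zero, Matrix.cons_val_one, Matrix.cons_val_two, Matrix.cons_val, Complex.real_smul, mul_zero, mul_one, zero_add]
    apply Complex.ext
    · simp [Complex.re_ofReal_mul]
      ring
    · simp [Complex.im_ofReal_mul, Complex.ofReal_im]
      field_simp

lemma triC_null : volume (triC \ triO) = 0 := by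
  rw [← triC_interior, ← triC_closed.frontier_eq]
  exact triC_convex.addHaar_frontier volume

lemma triC_inter (S : Set ℂ) : volume (triC ∩ S) = volume (triO ∩ S) := by
  apply le_antisymm
  · refine (measure_mono (t := (triO ∩ S) ∪ (triC \ triO)) ?_).trans ((measure_union_le _ _).trans ?_)
    · rintro x ⟨h1, h2⟩
      by_cases h : x ∈ triO
      · exact Or.inl ⟨h, h2⟩
      · exact Or.inr ⟨h1, h⟩
    · rw [triC_null, add_zero]
  · exact measure_mono (Set.inter_subset_inter_left _ triO_sub_triC)

lemma triO_vol : volume triO = ENNReal.ofReal (Real.sqrt 3 / 4) := by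
  have h30 : 0 < Real.sqrt 3 := Real.sqrt_pos.2 (by norm_num)
  rw [← Complex.volume_preserving_equiv_real_prod.symm.measure_preimage_equiv]
  have e : (Complex.measurableEquivRealProd.symm ⁻¹' triO) =
      regionBetween (fun _ => 0) (fun x => min (Real.sqrt 3 * x) (Real.sqrt 3 * (1 - x))) (Set.Ioc 0 1) := by
    ext ⟨x, y⟩
    simp only [triO, regionBetween, Set.mem_preimage, Set.mem_ofPred_eq, Set.mem_Ioo, Set.mem_Ioc, lt_min_iff,
      Complex.measurableEquivRealProd_symm_apply]
    constructor
    · rintro ⟨a, b, c⟩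
      refine ⟨⟨?_, ?_⟩, a, b, c⟩
      · by_contra h; nlinarith
      · by_contra h; nlinarith
    · rintro ⟨_, a, b, c⟩; exact ⟨a, b, c⟩
  rw [e, Measure.volume_eq_prod, volume_regionBetween_eq_integral]
  · congr 1
    rw [← intervalIntegral.integral_of_le zero_le_one]
    have hi : ∀ a b : ℝ, IntervalIntegrable (fun x => min (Real.sqrt 3 * x) (Real.sqrt 3 * (1 - x))) volume a b := by
      intro a b
      apply Continuous.intervalIntegrable
      fun_prop
    simp only [Pi.sub_apply, sub_zero]
    rw [← intervalIntegral.integral_add_adjacent_intervals (hi 0 (1/2)) (hi (1/2) 1)]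
    have i1 : ∫ x in (0:ℝ)..(1/2), min (Real.sqrt 3 * x) (Real.sqrt 3 * (1 - x)) = ∫ x in (0:ℝ)..(1/2), Real.sqrt 3 * x := by
      apply intervalIntegral.integral_congr
      intro x hx
      rw [Set.uIcc_of_le (by norm_num)] at hx
      apply min_eq_left
      nlinarith [hx.2]
    have i2 : ∫ x in (1/2:ℝ)..1, min (Real.sqrt 3 * x) (Real.sqrt 3 * (1 - x)) = ∫ x in (1/2:ℝ)..1, Real.sqrt 3 * (1 - x) := by
      apply intervalIntegral.integral_congr
      intro x hx
      rw [Set.uIcc_of_le (by norm_num)] at hx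
      apply min_eq_right
      nlinarith [hx.1]
    rw [i1, i2, intervalIntegral.integral_const_mul, intervalIntegral.integral_const_mul, integral_id,
      intervalIntegral.integral_sub (by simp) (by simp), integral_id]
    simp
    ring
  · exact integrableOn_zero
  · exact (Continuous.integrableOn_Icc (by fun_prop)).mono_set Set.Ioc_subset_Icc_self
  · exact measurableSet_Ioc
  · intro x hx
    exact le_min (by nlinarith [hx.1]) (by nlinarith [hx.2])

lemma sector_vol {R : ℝ} (hR : 0 ≤ R) : volume (cone ∩ Metric.closedBall 0 R) = ENNReal.ofReal (Real.pi * R ^ 2 / 6) := by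
  have hpi := Real.pi_pos
  have hm : MeasurableSet (Metric.closedBall (0:ℂ) R) := Metric.isClosed_closedBall.measurableSet
  have h := polar_change (F := (Metric.closedBall (0:ℂ) R).indicator (fun _ => 1)) hR (by
    intro z hz
    apply Set.indicator_of_notMem
    simpa using hz) (by
    have : IntegrableOn (fun p : ℝ × ℝ => p.1) (Set.Ioc 0 R ×ˢ Set.Ioc 0 (Real.pi / 3)) := by
      have : IntegrableOn (fun p : ℝ × ℝ => p.1) (Set.Icc 0 R ×ˢ Set.Icc 0 (Real.pi / 3)) :=
        continuous_fst.continuousOn.integrableOn_compact (isCompact_Icc.prod isCompact_Icc)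
      exact this.mono_set (Set.prod_mono Set.Ioc_subset_Icc_self Set.Ioc_subset_Icc_self)
    refine this.congr_fun ?_ (measurableSet_Ioc.prod measurableSet_Ioc)
    rintro ⟨r, θ⟩ ⟨h1, h2⟩
    simp only at h1 ⊢
    rw [Set.indicator_of_mem, mul_one]
    simp [Complex.norm_exp_ofReal_mul_I, abs_of_pos h1.1, h1.2])
  have hr : ∫ θ in (0:ℝ)..(Real.pi/3), ∫ r in (0:ℝ)..R, r * (Metric.closedBall (0:ℂ) R).indicator (fun _ => (1:ℝ)) (r * Complex.exp (θ * Complex.I))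
      = Real.pi * R ^ 2 / 6 := by
    have : ∀ θ : ℝ, ∫ r in (0:ℝ)..R, r * (Metric.closedBall (0:ℂ) R).indicator (fun _ => (1:ℝ)) (r * Complex.exp (θ * Complex.I)) = R ^ 2 / 2 := by
      intro θ
      rw [intervalIntegral.integral_congr (g := fun r => r)]
      · simp
      · intro r hr
        rw [Set.uIcc_of_le hR] at hr
        simp only
        rw [Set.indicator_of_mem, mul_one]
        simp [Complex.norm_exp_ofReal_mul_I, abs_of_nonneg hr.1, hr.2]
    simp only [this]
    simp
    ring
  rw [hr, setIntegral_indicator hm, setIntegral_const, smul_eq_mul, mul_one] at h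
  rw [← h, Measure.real, ENNReal.ofReal_toReal]
  exact ((measure_mono Set.inter_subset_right).trans_lt measure_closedBall_lt_top).ne

lemma arc_hm {R : ℝ} (hR : 0 < R) : μH[1] (cone ∩ Metric.sphere (0:ℂ) R) ≤ ENNReal.ofReal (R * (Real.pi / 3)) := by
  have hpi := Real.pi_pos
  have hL : LipschitzWith (Real.toNNReal R) (fun θ : ℝ => (R * Complex.exp (θ * Complex.I) : ℂ)) := by
    apply lipschitzWith_of_nnnorm_deriv_le
    · fun_prop
    · intro x
      have hd : HasDerivAt (fun θ : ℝ => (R * Complex.exp (θ * Complex.I) : ℂ)) (R * (Complex.exp (x * Complex.I) * (1 * Complex.I))) x := by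
        have h1 : HasDerivAt (fun θ : ℝ => (θ : ℂ)) 1 x := Complex.ofRealCLM.hasDerivAt
        exact ((h1.mul_const Complex.I).cexp).const_mul _
      rw [hd.deriv, ← NNReal.coe_le_coe, coe_nnnorm, Real.coe_toNNReal _ hR.le]
      simp [Complex.norm_exp_ofReal_mul_I, abs_of_pos hR]
  have hs : cone ∩ Metric.sphere (0:ℂ) R ⊆ (fun θ : ℝ => (R * Complex.exp (θ * Complex.I) : ℂ)) '' Set.Ioo 0 (Real.pi / 3) := by
    rintro z ⟨h1, h2⟩
    have hn : ‖z‖ = R := by simpa using h2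
    have hz : (R * Complex.exp (z.arg * Complex.I) : ℂ) = z := by
      rw [← hn]; exact Complex.norm_mul_exp_arg_mul_I z
    refine ⟨z.arg, ?_, hz⟩
    refine (cone_polar hR ⟨Complex.neg_pi_lt_arg z, lt_of_le_of_ne (Complex.arg_le_pi z) ?_⟩).1 (by rw [hz]; exact h1)
    intro h
    exact absurd (Complex.arg_eq_pi_iff.1 h).2 h1.1.ne'
  refine (measure_mono hs).trans ((hL.hausdorffMeasure_image_le zero_le_one _).trans ?_)
  rw [MeasureTheory.hausdorffMeasure_real, Real.volume_Ioo, ENNReal.rpow_one, sub_zero, ENNReal.ofReal_mul hR.le]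
  rfl

end

section
open MeasureTheory

lemma exists_phi {A B C : EuclideanSpace ℝ (Fin 2)} (hAB : dist A B = 1) (hBC : dist B C = 1) (hCA : dist C A = 1) :
    ∃ Φ : EuclideanSpace ℝ (Fin 2) ≃ᵢ ℂ, Φ '' (convexHull ℝ {A, B, C}) = triC := by
  have h30 : 0 < Real.sqrt 3 := Real.sqrt_pos.2 (by norm_num)
  have h3 : Real.sqrt 3 * Real.sqrt 3 = 3 := Real.mul_self_sqrt (by norm_num)
  suffices h : ∃ L : EuclideanSpace ℝ (Fin 2) ≃ₗᵢ[ℝ] ℂ, L (B - A) = 1 ∧ L (C - A) = ⟨1/2, Real.sqrt 3 / 2⟩ by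
    obtain ⟨L, l1, l2⟩ := h
    let Ψ : EuclideanSpace ℝ (Fin 2) ≃ᵃⁱ[ℝ] ℂ := (AffineIsometryEquiv.vaddConst ℝ A).symm.trans L.toAffineIsometryEquiv
    have hΨ : ∀ x, Ψ x = L (x - A) := fun x => rfl
    refine ⟨Ψ.toIsometryEquiv, ?_⟩
    rw [← triC_hull]
    have := (Ψ.toAffineEquiv.toAffineMap).image_convexHull {A, B, C}
    have e : (⇑(Ψ.toAffineEquiv.toAffineMap) : EuclideanSpace ℝ (Fin 2) → ℂ) = Ψ.toIsometryEquiv := rfl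
    rw [e] at this
    rw [this]
    congr 1
    rw [Set.image_insert_eq, Set.image_pair]
    have e2 : ∀ x, Ψ.toIsometryEquiv x = L (x - A) := fun x => rfl
    rw [e2, e2, e2, l1, l2, sub_self, map_zero]
  let e : EuclideanSpace ℝ (Fin 2) ≃ₗᵢ[ℝ] ℂ := Complex.orthonormalBasisOneI.repr.symm
  have hb : ‖e (B - A)‖ = 1 := by rw [e.norm_map, ← dist_eq_norm, dist_comm, hAB]
  let u : Circle := ⟨e (B - A), by simpa [Submonoid.unitSphere] using hb⟩
  let L1 : EuclideanSpace ℝ (Fin 2) ≃ₗᵢ[ℝ] ℂ := e.trans (rotation u⁻¹)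
  have l1 : L1 (B - A) = 1 := by
    show rotation u⁻¹ (e (B - A)) = 1
    rw [rotation_apply]
    show ((u⁻¹ : Circle) : ℂ) * (u : ℂ) = 1
    rw [← Circle.coe_mul, inv_mul_cancel, Circle.coe_one]
  obtain ⟨w, hw⟩ : ∃ w, w = L1 (C - A) := ⟨_, rfl⟩
  have w1 : ‖w‖ = 1 := by rw [hw, L1.norm_map, ← dist_eq_norm, hCA]
  have w2 : ‖w - 1‖ = 1 := by
    rw [hw, ← l1, ← map_sub, L1.norm_map, sub_sub_sub_cancel_right, ← dist_eq_norm, dist_comm, hBC]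
  have n1 : w.re * w.re + w.im * w.im = 1 := by
    have := Complex.normSq_eq_norm_sq w
    rw [w1, Complex.normSq_apply] at this; linarith
  have n2 : (w.re - 1) * (w.re - 1) + w.im * w.im = 1 := by
    have := Complex.normSq_eq_norm_sq (w - 1)
    rw [w2, Complex.normSq_apply] at this
    simp only [Complex.sub_re, Complex.one_re, Complex.sub_im, Complex.one_im, sub_zero] at this; linarith
  have wr : w.re = 1/2 := by linarith
  have wi : (w.im - Real.sqrt 3 / 2) * (w.im + Real.sqrt 3 / 2) = 0 := by
    rw [wr] at n1; linear_combination n1 - h3/4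
  rcases mul_eq_zero.1 wi with h | h
  · exact ⟨L1, l1, by rw [← hw]; exact Complex.ext wr (by simp only; linarith)⟩
  · refine ⟨L1.trans Complex.conjLIE, ?_, ?_⟩
    · show Complex.conjLIE (L1 (B - A)) = 1
      rw [l1]; simp
    · show Complex.conjLIE (L1 (C - A)) = _
      rw [← hw]
      exact Complex.ext (by simpa using wr) (by simp; linarith)

lemma upper (T : Set (EuclideanSpace ℝ (Fin 2))) (Φ : EuclideanSpace ℝ (Fin 2) ≃ᵢ ℂ) (hΦ : Φ '' T = triC) :
    ∃ U : Fin 2 → Set (EuclideanSpace ℝ (Fin 2)), (∀ i j, i ≠ j → Disjoint (U i) (U j)) ∧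
      (∀ i, ∃ V, IsOpen V ∧ U i = V ∩ T) ∧
      (∀ i, volume (U i) = ENNReal.ofReal ((Real.sqrt 3 / 4) / 2)) ∧
      μH[1] ((T \ ⋃ i, U i) ∩ interior T) ≤ ENNReal.ofReal (Real.sqrt (Real.sqrt 3 * Real.pi / 12)) := by
  have h30 : 0 < Real.sqrt 3 := Real.sqrt_pos.2 (by norm_num)
  have h3 : Real.sqrt 3 * Real.sqrt 3 = 3 := Real.mul_self_sqrt (by norm_num)
  have hpi := Real.pi_pos
  have hpi3 := Real.pi_gt_three
  obtain ⟨R, hR⟩ : ∃ R, R = Real.sqrt (3 * Real.sqrt 3 / (4 * Real.pi)) := ⟨_, rfl⟩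
  have R0 : 0 < R := by rw [hR]; positivity
  have R2 : R ^ 2 = 3 * Real.sqrt 3 / (4 * Real.pi) := by rw [hR, Real.sq_sqrt (by positivity)]
  have R3 : R < Real.sqrt 3 / 2 := by
    apply lt_of_pow_lt_pow_left₀ 2 (by positivity)
    rw [R2, div_lt_iff₀ (by positivity)]
    have hlt : Real.sqrt 3 < 2 := by nlinarith
    have e : (Real.sqrt 3 / 2) ^ 2 = 3 / 4 := by linear_combination h3 / 4
    rw [e]
    linarith
  have hval : R * (Real.pi / 3) = Real.sqrt (Real.sqrt 3 * Real.pi / 12) := by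
    symm
    rw [Real.sqrt_eq_iff_mul_self_eq (by positivity) (by positivity)]
    have : R * (Real.pi / 3) * (R * (Real.pi / 3)) = R ^ 2 * (Real.pi / 3) ^ 2 := by ring
    rw [this, R2]
    field_simp
    norm_num
  have hcb : triO ∩ Metric.closedBall 0 R = cone ∩ Metric.closedBall 0 R := by
    ext z
    constructor
    · rintro ⟨h, h'⟩; exact ⟨⟨h.1, h.2.1⟩, h'⟩
    · rintro ⟨h, h'⟩
      refine ⟨⟨h.1, h.2, ?_⟩, h'⟩
      have hn : ‖z‖ ≤ R := by simpa using h'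
      have hs : z.re * z.re + z.im * z.im < 3/4 := by
        have := Complex.normSq_eq_norm_sq z
        rw [Complex.normSq_apply] at this
        nlinarith [norm_nonneg z]
      have : Real.sqrt 3 * z.re + z.im < Real.sqrt 3 := by
        apply lt_of_pow_lt_pow_left₀ 2 h30.le
        nlinarith [sq_nonneg (z.re - Real.sqrt 3 * z.im)]
      linarith
  have hT : T = Φ ⁻¹' triC := by rw [← hΦ, Set.preimage_image_eq _ Φ.injective]
  have hTi : interior T = Φ ⁻¹' triO := by
    rw [hT, ← triC_interior]; exact (Φ.toHomeomorph.preimage_interior triC).symm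
  have vcb : volume (triC ∩ Metric.closedBall 0 R) = ENNReal.ofReal (Real.sqrt 3 / 4 / 2) := by
    rw [triC_inter, hcb, sector_vol R0.le, R2]
    congr 1; field_simp; norm_num
  have vb : volume (triC ∩ Metric.ball 0 R) = ENNReal.ofReal (Real.sqrt 3 / 4 / 2) := by
    rw [← vcb]
    apply le_antisymm (measure_mono (Set.inter_subset_inter_right _ Metric.ball_subset_closedBall))
    refine (measure_mono (t := (triC ∩ Metric.ball 0 R) ∪ Metric.sphere 0 R) ?_).trans ((measure_union_le _ _).trans ?_)
    · rw [← Metric.ball_union_sphere]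
      rintro x ⟨h1, h2 | h2⟩
      · exact Or.inl ⟨h1, h2⟩
      · exact Or.inr h2
    · rw [Measure.addHaar_sphere, add_zero]
  have vt : volume triC = ENNReal.ofReal (Real.sqrt 3 / 4) := by
    have := triC_inter Set.univ
    rwa [Set.inter_univ, Set.inter_univ, triO_vol] at this
  have vc : volume (triC ∩ (Metric.closedBall 0 R)ᶜ) = ENNReal.ofReal (Real.sqrt 3 / 4 / 2) := by
    have := measure_inter_add_sdiff (μ := volume) triC (Metric.isClosed_closedBall (x := (0:ℂ)) (ε := R)).measurableSet
    rw [vcb, vt, Set.sdiff_eq] at this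
    have e : ENNReal.ofReal (Real.sqrt 3 / 4) = ENNReal.ofReal (Real.sqrt 3 / 4 / 2) + ENNReal.ofReal (Real.sqrt 3 / 4 / 2) := by
      rw [← ENNReal.ofReal_add (by positivity) (by positivity)]; congr 1; ring
    rw [e] at this
    exact (ENNReal.add_right_inj ENNReal.ofReal_ne_top).1 this
  have hvp : ∀ S : Set ℂ, volume (Φ ⁻¹' S) = volume S := by
    intro S
    rw [← isom_vol Φ, Set.image_preimage_eq _ Φ.surjective]
  refine ⟨![Φ ⁻¹' (triC ∩ Metric.ball 0 R), Φ ⁻¹' (triC ∩ (Metric.closedBall 0 R)ᶜ)], ?_, ?_, ?_, ?_⟩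
  · have hd : Disjoint (Φ ⁻¹' (triC ∩ Metric.ball 0 R)) (Φ ⁻¹' (triC ∩ (Metric.closedBall 0 R)ᶜ)) := by
      rw [Set.disjoint_left]
      intro x h1 h2
      exact h2.2 (Metric.ball_subset_closedBall h1.2)
    intro i j hij
    fin_cases i <;> fin_cases j
    · exact absurd rfl hij
    · exact hd
    · exact hd.symm
    · exact absurd rfl hij
  · intro i
    fin_cases i
    · exact ⟨Φ ⁻¹' Metric.ball 0 R, Metric.isOpen_ball.preimage Φ.continuous, by rw [hT]; exact Set.inter_comm (Φ ⁻¹' triC) _⟩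
    · exact ⟨Φ ⁻¹' (Metric.closedBall 0 R)ᶜ, Metric.isClosed_closedBall.isOpen_compl.preimage Φ.continuous, by rw [hT]; exact Set.inter_comm (Φ ⁻¹' triC) _⟩
  · intro i
    fin_cases i
    · exact (hvp _).trans vb
    · exact (hvp _).trans vc
  · rw [← hval]
    refine le_trans ?_ (arc_hm R0)
    rw [← isom_hm Φ]
    apply measure_mono
    rintro _ ⟨x, ⟨⟨h1, h2⟩, h4⟩, rfl⟩
    rw [hTi] at h4
    have h5 : Φ x ∈ triO := h4
    rw [Set.mem_iUnion] at h2
    push Not at h2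
    have k0 : ¬ (Φ x ∈ triC ∩ Metric.ball 0 R) := h2 0
    have k1 : ¬ (Φ x ∈ triC ∩ (Metric.closedBall 0 R)ᶜ) := h2 1
    refine ⟨⟨h5.1, h5.2.1⟩, ?_⟩
    have hc := triO_sub_triC h5
    have a0 : ¬ Φ x ∈ Metric.ball 0 R := fun h => k0 ⟨hc, h⟩
    have a1 : Φ x ∈ Metric.closedBall 0 R := by
      by_contra h; exact k1 ⟨hc, h⟩
    rw [← Metric.ball_union_sphere] at a1
    exact a1.resolve_left a0

lemma lowerT (T : Set (EuclideanSpace ℝ (Fin 2))) (Φ : EuclideanSpace ℝ (Fin 2) ≃ᵢ ℂ) (hΦ : Φ '' T = triC)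
    (U : Fin 2 → Set (EuclideanSpace ℝ (Fin 2))) (hd : ∀ i j, i ≠ j → Disjoint (U i) (U j))
    (ho : ∀ i, ∃ V, IsOpen V ∧ U i = V ∩ T)
    (hv : ∀ i, volume (U i) = ENNReal.ofReal ((Real.sqrt 3 / 4) / 2)) :
    ENNReal.ofReal (Real.sqrt 3 * Real.pi / 12) ≤ (μH[1] ((T \ ⋃ i, U i) ∩ interior T)) ^ 2 := by
  have hT : T = Φ ⁻¹' triC := by rw [← hΦ, Set.preimage_image_eq _ Φ.injective]
  have hTi : interior T = Φ ⁻¹' triO := by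
    rw [hT, ← triC_interior]; exact (Φ.toHomeomorph.preimage_interior triC).symm
  have hTi' : Φ '' interior T = triO := by rw [hTi, Set.image_preimage_eq _ Φ.surjective]
  have hn : volume (T \ interior T) = 0 := by
    rw [← isom_vol Φ, Set.image_sdiff Φ.injective, hΦ, hTi', triC_null]
  have hop : ∀ i, IsOpen (Φ '' (U i ∩ interior T)) := by
    intro i
    obtain ⟨V, hV, hU⟩ := ho i
    apply Φ.toHomeomorph.isOpenMap
    have : U i ∩ interior T = V ∩ interior T := by
      rw [hU, Set.inter_assoc, Set.inter_eq_right.2 interior_subset]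
    rw [this]
    exact hV.inter isOpen_interior
  have hvol : ∀ i, volume (Φ '' (U i ∩ interior T)) = ENNReal.ofReal ((Real.sqrt 3 / 4) / 2) := by
    intro i
    obtain ⟨V, hV, hU⟩ := ho i
    rw [isom_vol, ← hv i]
    apply le_antisymm (measure_mono Set.inter_subset_left)
    refine (measure_mono (t := (U i ∩ interior T) ∪ (T \ interior T)) ?_).trans ((measure_union_le _ _).trans ?_)
    · intro x hx
      by_cases h : x ∈ interior T
      · exact Or.inl ⟨hx, h⟩
      · exact Or.inr ⟨by rw [hU] at hx; exact hx.2, h⟩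
    · rw [hn, add_zero]
  have hs : ∀ i, Φ '' (U i ∩ interior T) ⊆ triO := by
    intro i
    rw [← hTi']
    exact Set.image_mono Set.inter_subset_right
  have hdis : Disjoint (Φ '' (U 0 ∩ interior T)) (Φ '' (U 1 ∩ interior T)) := by
    rw [Set.disjoint_image_iff Φ.injective]
    exact (hd 0 1 (by simp)).mono Set.inter_subset_left Set.inter_subset_left
  have key := lower (hop 0) (hop 1) hdis (hs 0) (hs 1) (hvol 0) (hvol 1)
  rw [← hTi', ← Set.image_union, ← Set.image_sdiff Φ.injective, isom_hm] at key
  convert key using 3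
  ext x
  simp only [Set.mem_inter_iff, Set.mem_sdiff, Set.mem_iUnion, Fin.exists_fin_two, Set.mem_union]
  constructor
  · rintro ⟨⟨a, b⟩, c⟩
    exact ⟨c, fun h => b (h.imp And.left And.left)⟩
  · rintro ⟨a, b⟩
    exact ⟨⟨interior_subset a, fun h => b (h.imp (fun h => ⟨h, a⟩) (fun h => ⟨h, a⟩))⟩, a⟩

end

/-- **Theorem 3.1.** `l₂,₃ = √(√3·π/12)`: the infimum of the dividing lengths over all
2-part equal-area divisions of a closed unit equilateral triangle is `√(√3·π/12)`. -/
theorem stmt_10 (A B C : EuclideanSpace ℝ (Fin 2))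
    (hAB : dist A B = 1) (hBC : dist B C = 1) (hCA : dist C A = 1)
    (T : Set (EuclideanSpace ℝ (Fin 2)))
    (hT : T = convexHull ℝ ({A, B, C} : Set (EuclideanSpace ℝ (Fin 2)))) :
    sInf { L : ℝ | ∃ U : Fin 2 → Set (EuclideanSpace ℝ (Fin 2)),
        (∀ i j, i ≠ j → Disjoint (U i) (U j)) ∧
        (∀ i, ∃ V : Set (EuclideanSpace ℝ (Fin 2)), IsOpen V ∧ U i = V ∩ T) ∧
        (∀ i, volume (U i) = ENNReal.ofReal ((Real.sqrt 3 / 4) / 2)) ∧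
        0 ≤ L ∧
        μH[1] ((T \ ⋃ i, U i) ∩ interior T) = ENNReal.ofReal L } =
      Real.sqrt (Real.sqrt 3 * Real.pi / 12) := by
  obtain ⟨Φ, hΦ'⟩ := exists_phi hAB hBC hCA
  have hΦ : Φ '' T = triC := by rw [hT]; exact hΦ'
  have low : ∀ L ∈ { L : ℝ | ∃ U : Fin 2 → Set (EuclideanSpace ℝ (Fin 2)),
        (∀ i j, i ≠ j → Disjoint (U i) (U j)) ∧
        (∀ i, ∃ V : Set (EuclideanSpace ℝ (Fin 2)), IsOpen V ∧ U i = V ∩ T) ∧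
        (∀ i, volume (U i) = ENNReal.ofReal ((Real.sqrt 3 / 4) / 2)) ∧
        0 ≤ L ∧
        μH[1] ((T \ ⋃ i, U i) ∩ interior T) = ENNReal.ofReal L },
        Real.sqrt (Real.sqrt 3 * Real.pi / 12) ≤ L := by
    rintro L ⟨U, h1, h2, h3, h4, h5⟩
    have h := lowerT T Φ hΦ U h1 h2 h3
    rw [h5, ← ENNReal.ofReal_pow h4, ENNReal.ofReal_le_ofReal_iff (by positivity)] at h
    exact Real.sqrt_le_iff.2 ⟨h4, h⟩
  obtain ⟨U, h1, h2, h3, h4⟩ := upper T Φ hΦ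
  have hmem : (μH[1] ((T \ ⋃ i, U i) ∩ interior T)).toReal ∈ { L : ℝ | ∃ U : Fin 2 → Set (EuclideanSpace ℝ (Fin 2)),
        (∀ i j, i ≠ j → Disjoint (U i) (U j)) ∧
        (∀ i, ∃ V : Set (EuclideanSpace ℝ (Fin 2)), IsOpen V ∧ U i = V ∩ T) ∧
        (∀ i, volume (U i) = ENNReal.ofReal ((Real.sqrt 3 / 4) / 2)) ∧
        0 ≤ L ∧
        μH[1] ((T \ ⋃ i, U i) ∩ interior T) = ENNReal.ofReal L } :=
    ⟨U, h1, h2, h3, ENNReal.toReal_nonneg,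
      (ENNReal.ofReal_toReal (ne_top_of_le_ne_top ENNReal.ofReal_ne_top h4)).symm⟩
  apply le_antisymm
  · refine (csInf_le ⟨_, low⟩ hmem).trans ?_
    exact ENNReal.toReal_le_of_le_ofReal (Real.sqrt_nonneg _) h4
  · exact le_csInf ⟨_, hmem⟩ low
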